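/- For all integers p ≥ 1, 1 ≤ j ≤ 2^p and n ≥ 3·2^p − 1, one has H(n, 3·2^p − 2 + j) ≥ (p/2 + 2/3)n − ((p + 13/3)·2^{p−1} − (p + 4/3)). -/

import Mathlib

open Filter Polynomial

/-- `Γ` is a periodic orbit of the planar vector field `V`: the image of a
nonconstant periodic solution of `γ' = V ∘ γ`. -/
def IsPeriodicOrbit (V : ℝ × ℝ → ℝ × ℝ) (Γ : Set (ℝ × ℝ)) : Prop :=
  ∃ γ : ℝ → ℝ × ℝ,
    (∀ t : ℝ, HasDerivAt γ (V (γ t)) t) ∧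
    (∃ T : ℝ, 0 < T ∧ Function.Periodic γ T) ∧
    (∃ t₁ t₂ : ℝ, γ t₁ ≠ γ t₂) ∧
    Γ = Set.range γ

/-- `Γ` is a limit cycle of `V`: a periodic orbit which is isolated among
periodic orbits. -/
def IsLimitCycle (V : ℝ × ℝ → ℝ × ℝ) (Γ : Set (ℝ × ℝ)) : Prop :=
  IsPeriodicOrbit V Γ ∧
  ∃ U : Set (ℝ × ℝ), IsOpen U ∧ Γ ⊆ U ∧
    ∀ Γ' : Set (ℝ × ℝ), IsPeriodicOrbit V Γ' → Γ' ⊆ U → Γ' = Γ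

/-- The Liénard vector field `ẋ = y, ẏ = -g(x) - ε f(x) y`. -/
def lienard (f g : Polynomial ℝ) (ε : ℝ) : ℝ × ℝ → ℝ × ℝ :=
  fun p => (p.2, -(g.eval p.1) - ε * (f.eval p.1) * p.2)

/-- `HGe n m c` formalizes `H(n,m) ≥ c`: there are polynomials `f, g` with
`deg f ≤ n`, `deg g ≤ m` and `ε₀ > 0` such that for every `0 < ε ≤ ε₀` the
Liénard system has at least `c` pairwise distinct limit cycles. -/
def HGe (n m : ℕ) (c : ℝ) : Prop :=
  ∃ f g : Polynomial ℝ, f.natDegree ≤ n ∧ g.natDegree ≤ m ∧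
    ∃ ε₀ : ℝ, 0 < ε₀ ∧ ∀ ε : ℝ, 0 < ε → ε ≤ ε₀ →
      ∃ S : Finset (Set (ℝ × ℝ)),
        (∀ Γ ∈ S, IsLimitCycle (lienard f g ε) Γ) ∧ c ≤ (S.card : ℝ)

section PeriodicScalar

open Set Topology Real

/-- A statement which is periodic in `θ` and locally uniform near `(x₀, θ)` for each `θ`
is locally uniform near `x₀`. -/
lemma eventually_forall_of_periodic {X : Type*} [TopologicalSpace X] {x₀ : X} {P : X → ℝ → Prop}
    (hper : ∀ x θ, P x (θ + 2 * π) ↔ P x θ) (h : ∀ θ, ∀ᶠ z : X × ℝ in 𝓝 (x₀, θ), P z.1 z.2) :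
    ∀ᶠ x in 𝓝 x₀, ∀ θ, P x θ := by
  have := (isCompact_Icc (a := (0 : ℝ)) (b := 2 * π)).eventually_forall_of_forall_eventually
    (P := P) (fun θ _ => h θ)
  filter_upwards [this] with x hx θ
  have hp : Function.Periodic (fun θ => P x θ) (2 * π) := fun θ => propext (hper x θ)
  obtain ⟨y, hy, hxy⟩ := hp.exists_mem_Ico₀ (by positivity) θ
  have : P x θ = P x y := hxy
  rw [this]
  exact hx y ⟨hy.1, hy.2.le⟩

/-- A right-hand side `R (ε, h, θ)` which is `2π`-periodic in `θ` and `C¹` along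
`{0} × {h₀} × ℝ`. -/
structure IsPeriodicField (R : ℝ × ℝ × ℝ → ℝ) (h₀ : ℝ) : Prop where
  periodic : ∀ e h θ, R (e, h, θ + 2 * π) = R (e, h, θ)
  contDiffAt : ∀ θ, ContDiffAt ℝ 1 R (0, h₀, θ)

/-- The linearization of `R (0, ·, θ)` at `h₀`. -/
noncomputable def fieldSlope (R : ℝ × ℝ × ℝ → ℝ) (h₀ θ : ℝ) : ℝ :=
  fderiv ℝ R (0, h₀, θ) (0, 1, 0)

namespace IsPeriodicField

variable {R : ℝ × ℝ × ℝ → ℝ} {h₀ : ℝ}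

lemma continuous_fieldSlope (hR : IsPeriodicField R h₀) : Continuous (fieldSlope R h₀) := by
  rw [continuous_iff_continuousAt]
  intro θ
  have h1 : ContinuousAt (fderiv ℝ R) (0, h₀, θ) :=
    ((hR.contDiffAt θ).fderiv_right (m := 0) (by norm_num)).continuousAt
  have h2 : ContinuousAt (fun θ : ℝ => ((0 : ℝ), h₀, θ)) θ := by fun_prop
  have h3 : ContinuousAt (fun θ : ℝ => fderiv ℝ R (0, h₀, θ)) θ :=
    ContinuousAt.comp (f := fun θ : ℝ => ((0 : ℝ), h₀, θ)) (g := fderiv ℝ R) h1 h2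
  exact h3.clm_apply continuousAt_const

lemma hasDerivAt_slice (hR : IsPeriodicField R h₀) (θ : ℝ) :
    HasDerivAt (fun h => R (0, h, θ)) (fieldSlope R h₀ θ) h₀ := by
  have h1 : HasFDerivAt R (fderiv ℝ R (0, h₀, θ)) (0, h₀, θ) :=
    ((hR.contDiffAt θ).differentiableAt (by norm_num)).hasFDerivAt
  have h2 : HasDerivAt (fun h : ℝ => ((0 : ℝ), h, θ)) (0, 1, 0) h₀ :=
    (hasDerivAt_const h₀ (0 : ℝ)).prodMk ((hasDerivAt_id h₀).prodMk (hasDerivAt_const h₀ θ))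
  exact h1.comp_hasDerivAt h₀ h2

lemma fieldSlope_periodic (hR : IsPeriodicField R h₀) (θ : ℝ) :
    fieldSlope R h₀ (θ + 2 * π) = fieldSlope R h₀ θ := by
  refine (hR.hasDerivAt_slice (θ + 2 * π)).unique ?_
  simpa [hR.periodic] using hR.hasDerivAt_slice θ

lemma eventually_continuousAt (hR : IsPeriodicField R h₀) :
    ∀ᶠ q : ℝ × ℝ in 𝓝 (0, h₀), ∀ θ, ContDiffAt ℝ 1 R (q.1, q.2, θ) := by
  refine eventually_forall_of_periodic (P := fun (q : ℝ × ℝ) θ => ContDiffAt ℝ 1 R (q.1, q.2, θ)) ?_ ?_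
  · intro q θ
    have hsh : ∀ (c : ℝ) (θ : ℝ), (∀ e h θ, R (e, h, θ + c) = R (e, h, θ)) →
        ContDiffAt ℝ 1 R (q.1, q.2, θ + c) → ContDiffAt ℝ 1 R (q.1, q.2, θ) := by
      intro c θ hc h
      have h2 : ContDiffAt ℝ 1 (fun p : ℝ × ℝ × ℝ => (p.1, p.2.1, p.2.2 + c)) (q.1, q.2, θ) := by
        fun_prop
      have h3 : ContDiffAt ℝ 1 (fun p : ℝ × ℝ × ℝ => R (p.1, p.2.1, p.2.2 + c)) (q.1, q.2, θ) :=
        ContDiffAt.comp (q.1, q.2, θ) (g := R)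
          (f := fun p : ℝ × ℝ × ℝ => (p.1, p.2.1, p.2.2 + c)) h h2
      have h4 : (fun p : ℝ × ℝ × ℝ => R (p.1, p.2.1, p.2.2 + c)) = R := by
        ext ⟨a, b, d⟩; exact hc a b d
      rwa [h4] at h3
    constructor
    · exact hsh _ _ hR.periodic
    · intro h
      refine hsh (-(2 * π)) (θ + 2 * π) (fun e h θ => ?_) (by simpa using h)
      rw [← hR.periodic e h (θ + -(2 * π))]; simp
  · intro θ
    have h1 := (hR.contDiffAt θ).eventually (by simp)
    have h2 : Tendsto (fun z : (ℝ × ℝ) × ℝ => (z.1.1, z.1.2, z.2)) (𝓝 ((0, h₀), θ))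
        (𝓝 (0, h₀, θ)) := by
      have : Continuous (fun z : (ℝ × ℝ) × ℝ => (z.1.1, z.1.2, z.2)) := by fun_prop
      exact this.tendsto ((0, h₀), θ)
    exact h2.eventually h1

lemma eventually_linearized (hR : IsPeriodicField R h₀) {η : ℝ} (hη : 0 < η) :
    ∀ᶠ q : ℝ × ℝ × ℝ in 𝓝 (0, h₀, h₀), ∀ θ,
      |R (q.1, q.2.1, θ) - R (q.1, q.2.2, θ) - fieldSlope R h₀ θ * (q.2.1 - q.2.2)| ≤
        η * |q.2.1 - q.2.2| := by
  refine eventually_forall_of_periodic (P := fun (q : ℝ × ℝ × ℝ) θ =>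
    |R (q.1, q.2.1, θ) - R (q.1, q.2.2, θ) - fieldSlope R h₀ θ * (q.2.1 - q.2.2)| ≤
        η * |q.2.1 - q.2.2|) ?_ ?_
  · intro q θ
    simp only [hR.periodic, hR.fieldSlope_periodic]
  · intro θ₀
    have h1 := ((hR.contDiffAt θ₀).hasStrictFDerivAt (by norm_num)).isLittleO.bound
      (half_pos hη)
    have h2 : Tendsto (fun z : (ℝ × ℝ × ℝ) × ℝ =>
        (((z.1.1, z.1.2.1, z.2), (z.1.1, z.1.2.2, z.2)) : (ℝ × ℝ × ℝ) × (ℝ × ℝ × ℝ)))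
        (𝓝 ((0, h₀, h₀), θ₀)) (𝓝 ((0, h₀, θ₀), (0, h₀, θ₀))) := by
      have : Continuous (fun z : (ℝ × ℝ × ℝ) × ℝ =>
        (((z.1.1, z.1.2.1, z.2), (z.1.1, z.1.2.2, z.2)) : (ℝ × ℝ × ℝ) × (ℝ × ℝ × ℝ))) := by
        fun_prop
      exact this.tendsto ((0, h₀, h₀), θ₀)
    have h3 : ∀ᶠ z : (ℝ × ℝ × ℝ) × ℝ in 𝓝 ((0, h₀, h₀), θ₀),
        |fieldSlope R h₀ z.2 - fieldSlope R h₀ θ₀| < η / 2 := by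
      have : Continuous fun z : (ℝ × ℝ × ℝ) × ℝ =>
          |fieldSlope R h₀ z.2 - fieldSlope R h₀ θ₀| := by
        have := hR.continuous_fieldSlope
        fun_prop
      refine (this.tendsto ((0, h₀, h₀), θ₀)).eventually_lt_const ?_
      simpa using half_pos hη
    filter_upwards [h2.eventually h1, h3] with z hz hz3
    obtain ⟨⟨e, h, h'⟩, θ⟩ := z
    simp only [Prod.mk_sub_mk, sub_self, Real.norm_eq_abs] at hz hz3 ⊢
    have e1 : fderiv ℝ R (0, h₀, θ₀) (0, h - h', 0) = fieldSlope R h₀ θ₀ * (h - h') := by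
      have : ((0 : ℝ), h - h', (0 : ℝ)) = (h - h') • ((0 : ℝ), (1 : ℝ), (0 : ℝ)) := by
        simp
      rw [this, map_smul, fieldSlope, smul_eq_mul, mul_comm]
    have e2 : ‖((0 : ℝ), h - h', (0 : ℝ))‖ = |h - h'| := by
      simp [Prod.norm_def]
    rw [e1, e2] at hz
    have e3 : R (e, h, θ) - R (e, h', θ) - fieldSlope R h₀ θ * (h - h') =
      (R (e, h, θ) - R (e, h', θ) - fieldSlope R h₀ θ₀ * (h - h')) -
        (fieldSlope R h₀ θ - fieldSlope R h₀ θ₀) * (h - h') := by ring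
    rw [e3]
    refine (abs_sub _ _).trans ?_
    rw [abs_mul]
    nlinarith [abs_nonneg (h - h')]

lemma eventually_continuous_slice (hR : IsPeriodicField R h₀) :
    ∀ᶠ h in 𝓝 h₀, Continuous fun θ => R (0, h, θ) := by
  have h1 : Tendsto (fun h : ℝ => ((0 : ℝ), h)) (𝓝 h₀) (𝓝 (0, h₀)) :=
    (Continuous.prodMk_right (0 : ℝ)).tendsto h₀
  filter_upwards [h1.eventually hR.eventually_continuousAt] with h hh
  rw [continuous_iff_continuousAt]
  intro θ
  have h2 : ContinuousAt (fun θ : ℝ => ((0 : ℝ), h, θ)) θ := by fun_prop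
  exact ContinuousAt.comp (f := fun θ : ℝ => ((0 : ℝ), h, θ)) (g := R) (hh θ).continuousAt h2

/-- The average of `R (0, h, ·)` is differentiable at `h₀`. -/
lemma hasDerivAt_integral (hR : IsPeriodicField R h₀) :
    HasDerivAt (fun h => ∫ θ in (0 : ℝ)..2 * π, R (0, h, θ))
      (∫ θ in (0 : ℝ)..2 * π, fieldSlope R h₀ θ) h₀ := by
  rw [hasDerivAt_iff_isLittleO, Asymptotics.isLittleO_iff]
  intro c hc
  have hη : 0 < c / (2 * π) := by positivity
  have h1 : Tendsto (fun h : ℝ => ((0 : ℝ), h, h₀)) (𝓝 h₀) (𝓝 (0, h₀, h₀)) := by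
    have : Continuous (fun h : ℝ => ((0 : ℝ), h, h₀)) := by fun_prop
    exact this.tendsto h₀
  have hc0 := hR.eventually_continuous_slice.self_of_nhds
  filter_upwards [h1.eventually (hR.eventually_linearized hη), hR.eventually_continuous_slice]
    with h hh hc1
  have e1 : (∫ θ in (0 : ℝ)..2 * π, R (0, h, θ)) - (∫ θ in (0 : ℝ)..2 * π, R (0, h₀, θ)) -
      (h - h₀) • (∫ θ in (0 : ℝ)..2 * π, fieldSlope R h₀ θ) =
      ∫ θ in (0 : ℝ)..2 * π, (R (0, h, θ) - R (0, h₀, θ) - fieldSlope R h₀ θ * (h - h₀)) := by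
    have hs := hR.continuous_fieldSlope
    have i1 := (hc1.sub hc0).intervalIntegrable (μ := MeasureTheory.volume) 0 (2 * π)
    have i2 := (hs.mul_const (h - h₀)).intervalIntegrable (μ := MeasureTheory.volume) 0 (2 * π)
    rw [smul_eq_mul, mul_comm (h - h₀), ← intervalIntegral.integral_mul_const,
      ← intervalIntegral.integral_sub (hc1.intervalIntegrable _ _) (hc0.intervalIntegrable _ _)]
    exact (intervalIntegral.integral_sub i1 i2).symm
  rw [e1]
  refine (intervalIntegral.norm_integral_le_of_norm_le_const
    (C := c / (2 * π) * |h - h₀|) (fun θ _ => hh θ)).trans ?_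
  rw [sub_zero, abs_of_pos Real.two_pi_pos, Real.norm_eq_abs]
  apply le_of_eq
  field_simp

end IsPeriodicField

end PeriodicScalar

section PeriodicSolutions

open Set Topology Real NNReal

/-- Gluing: a solution on `[0, T]` of a `T`-periodic scalar equation which returns to its initial
value extends to a `T`-periodic solution on the line. -/
lemma exists_periodic_extension {F : ℝ → ℝ → ℝ} {T : ℝ} (hT : 0 < T)
    (hper : ∀ θ x, F (θ + T) x = F θ x) (hcont : Continuous (Function.uncurry F)) {α : ℝ → ℝ}
    (hα : ∀ θ ∈ Icc 0 T, HasDerivWithinAt α (F θ (α θ)) (Icc 0 T) θ) (hret : α T = α 0) :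
    ∃ β : ℝ → ℝ, (∀ θ, β (θ + T) = β θ) ∧ (∀ θ, HasDerivAt β (F θ (β θ)) θ) ∧
      ∀ θ, ∃ s ∈ Icc 0 T, β θ = α s := by
  have : Fact (0 < T) := ⟨hT⟩
  have hαc : ContinuousOn α (Icc 0 T) := fun θ hθ => (hα θ hθ).continuousWithinAt
  set β : ℝ → ℝ := fun θ => AddCircle.liftIco T 0 α (θ : AddCircle T) with hβ
  have hβc : Continuous β := by
    have h1 : Continuous (AddCircle.liftIco T 0 α) :=
      AddCircle.liftIco_continuous (by simpa using hret.symm) (by simpa using hαc)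
    exact h1.comp (AddCircle.continuous_mk' T)
  have hβper : Function.Periodic β T := fun θ => by simp [hβ]
  have hβα : ∀ θ ∈ Icc 0 T, β θ = α θ := by
    intro θ hθ
    rcases hθ.2.lt_or_eq with h | h
    · exact AddCircle.liftIco_coe_apply (by simpa using ⟨hθ.1, h⟩)
    · have h0 : β 0 = α 0 := AddCircle.liftIco_coe_apply (by simpa using hT)
      have h1 := hβper 0
      rw [zero_add] at h1
      rw [h, hret, h1, h0]
  have hval : ∀ θ, ∃ s ∈ Icc 0 T, β θ = α s := by
    intro θ
    obtain ⟨y, hy, hxy⟩ := hβper.exists_mem_Ico₀ hT θ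
    exact ⟨y, ⟨hy.1, hy.2.le⟩, hxy.trans (hβα y ⟨hy.1, hy.2.le⟩)⟩
  refine ⟨β, hβper, ?_, hval⟩
  have hgc : Continuous fun θ => F θ (β θ) := hcont.comp (continuous_id.prodMk hβc)
  have hgper : Function.Periodic (fun θ => F θ (β θ)) T := fun θ => by
    simp only [hβper θ, hper]
  have hftc : ∀ θ ∈ Icc 0 T, ∫ s in (0 : ℝ)..θ, F s (β s) = β θ - β 0 := by
    intro θ hθ
    have hsub : Icc 0 θ ⊆ Icc 0 T := Icc_subset_Icc_right hθ.2
    refine intervalIntegral.integral_eq_sub_of_hasDeriv_right_of_le hθ.1 hβc.continuousOn ?_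
      (hgc.intervalIntegrable _ _)
    intro x hx
    have hxT : x ∈ Ioo 0 T := ⟨hx.1, hx.2.trans_le hθ.2⟩
    have h1 : HasDerivAt α (F x (α x)) x :=
      (hα x (Ioo_subset_Icc_self hxT)).hasDerivAt (Icc_mem_nhds hxT.1 hxT.2)
    have h2 : β =ᶠ[𝓝 x] α := by
      filter_upwards [Icc_mem_nhds hxT.1 hxT.2] with y hy using hβα y hy
    have h3 := h1.congr_of_eventuallyEq h2
    rw [← hβα x (Ioo_subset_Icc_self hxT)] at h3
    exact h3.hasDerivWithinAt
  have hzero : ∫ s in (0 : ℝ)..T, F s (β s) = 0 := by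
    rw [hftc T ⟨hT.le, le_rfl⟩, hβα T ⟨hT.le, le_rfl⟩, hβα 0 ⟨le_rfl, hT.le⟩, hret, sub_self]
  have hI : Function.Periodic (fun θ => (∫ s in (0 : ℝ)..θ, F s (β s)) - β θ) T := by
    intro θ
    have h1 := intervalIntegral.integral_add_adjacent_intervals
      (hgc.intervalIntegrable 0 θ) (hgc.intervalIntegrable (μ := MeasureTheory.volume) θ (θ + T))
    have h2 := hgper.intervalIntegral_add_eq θ 0
    rw [zero_add, hzero] at h2
    simp only [hβper θ, ← h1, h2, add_zero]
  have hall : ∀ θ, β θ = β 0 + ∫ s in (0 : ℝ)..θ, F s (β s) := by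
    intro θ
    obtain ⟨y, hy, hxy⟩ := hI.exists_mem_Ico₀ hT θ
    have := hftc y ⟨hy.1, hy.2.le⟩
    linarith
  intro θ
  have h1 : HasDerivAt (fun θ => β 0 + ∫ s in (0 : ℝ)..θ, F s (β s)) (F θ (β θ)) θ :=
    (intervalIntegral.integral_hasDerivAt_right (hgc.intervalIntegrable _ _)
      (hgc.stronglyMeasurableAtFilter _ _) hgc.continuousAt).const_add _
  exact h1.congr_of_eventuallyEq (Eventually.of_forall hall)

/-- Existence of a periodic solution of a scalar periodic equation from a sign change of the
displacement. -/
lemma exists_periodic_of_sign {F : ℝ → ℝ → ℝ} {K L : ℝ≥0} {T : ℝ} (hT : 0 < T)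
    (hper : ∀ θ x, F (θ + T) x = F θ x) (hcont : Continuous (Function.uncurry F))
    (hLip : ∀ θ, LipschitzWith K (F θ)) (hL : ∀ θ x, |F θ x| ≤ L) {c d : ℝ} (hcd : c ≤ d)
    {s : ℝ} (hs : s ≠ 0)
    (hc : ∀ α : ℝ → ℝ, ContinuousOn α (Icc 0 T) → (∀ θ ∈ Icc 0 T, |α θ - c| ≤ L * T) →
      s * ∫ θ in (0 : ℝ)..T, F θ (α θ) ≤ 0)
    (hd : ∀ α : ℝ → ℝ, ContinuousOn α (Icc 0 T) → (∀ θ ∈ Icc 0 T, |α θ - d| ≤ L * T) →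
      0 ≤ s * ∫ θ in (0 : ℝ)..T, F θ (α θ)) :
    ∃ β : ℝ → ℝ, (∀ θ, β (θ + T) = β θ) ∧ (∀ θ, HasDerivAt β (F θ (β θ)) θ) ∧
      ∀ θ, c - L * T ≤ β θ ∧ β θ ≤ d + L * T := by
  set r : ℝ≥0 := ⟨(d - c) / 2, by linarith⟩ with hr
  set T' : ℝ≥0 := ⟨T, hT.le⟩ with hT'
  have hpl : IsPicardLindelof F (tmin := 0) (tmax := T) ⟨0, le_rfl, hT.le⟩ ((c + d) / 2)
      (r + L * T') r L K :=
    { lipschitzOnWith := fun t _ => (hLip t).lipschitzOnWith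
      continuousOn := fun x _ => by
        have : Continuous fun t => F t x := hcont.comp (by fun_prop : Continuous fun t => (t, x))
        exact this.continuousOn
      norm_le := fun t _ x _ => hL t x
      mul_max_le := by
        simp only [hT', sub_zero, sub_self, max_eq_left hT.le, NNReal.coe_add, add_sub_cancel_left]
        exact le_rfl }
  obtain ⟨A, hA, L', hA'⟩ := hpl.exists_forall_mem_closedBall_eq_hasDerivWithinAt_lipschitzOnWith
  have hmem : ∀ x ∈ Icc c d, x ∈ Metric.closedBall ((c + d) / 2) (r : ℝ) := by
    intro x hx
    rw [Metric.mem_closedBall, Real.dist_eq, abs_le, hr]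
    change -((d - c) / 2) ≤ _ ∧ _ ≤ (d - c) / 2
    constructor <;> linarith [hx.1, hx.2]
  have hTm : T ∈ Icc (0 : ℝ) T := ⟨hT.le, le_rfl⟩
  have hAcont : ∀ x ∈ Icc c d, ContinuousOn (A x) (Icc 0 T) := fun x hx θ hθ =>
    ((hA x (hmem x hx)).2 θ hθ).continuousWithinAt
  have hA0 : ∀ x ∈ Icc c d, A x 0 = x := fun x hx => (hA x (hmem x hx)).1
  have hAbd : ∀ x ∈ Icc c d, ∀ θ ∈ Icc 0 T, |A x θ - x| ≤ L * T := by
    intro x hx θ hθ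
    have h1 := (convex_Icc (0 : ℝ) T).norm_image_sub_le_of_norm_hasDerivWithin_le (C := L)
      (fun θ hθ => (hA x (hmem x hx)).2 θ hθ) (fun θ _ => hL θ _)
      (⟨le_rfl, hT.le⟩ : (0 : ℝ) ∈ Icc 0 T) hθ
    rw [hA0 x hx, Real.norm_eq_abs, Real.norm_eq_abs, sub_zero, abs_of_nonneg hθ.1] at h1
    exact h1.trans (mul_le_mul_of_nonneg_left hθ.2 L.2)
  have hftc : ∀ x ∈ Icc c d, ∫ θ in (0 : ℝ)..T, F θ (A x θ) = A x T - x := by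
    intro x hx
    have h1 : ContinuousOn (fun θ => F θ (A x θ)) (Icc 0 T) :=
      hcont.comp_continuousOn (continuousOn_id.prodMk (hAcont x hx))
    have h2 := intervalIntegral.integral_eq_sub_of_hasDeriv_right_of_le hT.le (hAcont x hx)
      (f' := fun θ => F θ (A x θ)) (fun θ hθ => ?_) (h1.intervalIntegrable_of_Icc hT.le)
    · rw [h2, hA0 x hx]
    · exact (((hA x (hmem x hx)).2 θ (Ioo_subset_Icc_self hθ)).hasDerivAt
        (Icc_mem_nhds hθ.1 hθ.2)).hasDerivWithinAt
  have hcm : c ∈ Icc c d := ⟨le_rfl, hcd⟩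
  have hdm : d ∈ Icc c d := ⟨hcd, le_rfl⟩
  have hcontA : ContinuousOn (fun x => s * (A x T - x)) (Icc c d) := by
    have h1 : ContinuousOn (fun x => A x T) (Icc c d) := (hA' T hTm).continuousOn.mono hmem
    fun_prop
  have h0 : (0 : ℝ) ∈ Icc (s * (A c T - c)) (s * (A d T - d)) := by
    constructor
    · rw [← hftc c hcm]; exact hc _ (hAcont c hcm) (hAbd c hcm)
    · rw [← hftc d hdm]; exact hd _ (hAcont d hdm) (hAbd d hdm)
  obtain ⟨x, hx, hx0⟩ := intermediate_value_Icc hcd hcontA h0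
  have hxT : A x T = A x 0 := by
    rw [hA0 x hx]
    have := (mul_eq_zero.mp hx0).resolve_left hs
    linarith
  obtain ⟨β, hβ1, hβ2, hβ3⟩ :=
    exists_periodic_extension hT hper hcont (hA x (hmem x hx)).2 hxT
  refine ⟨β, hβ1, hβ2, fun θ => ?_⟩
  obtain ⟨u, hu, hβu⟩ := hβ3 θ
  have := abs_le.mp (hAbd x hx u hu)
  rw [hβu]
  constructor <;> linarith [hx.1, hx.2, this.1, this.2]

end PeriodicSolutions

section IsolatedPeriodic

open Set Topology Real NNReal

lemma Monotone.eq_of_periodic {f : ℝ → ℝ} {T : ℝ} (hf : Monotone f) (hT : 0 < T)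
    (hp : Function.Periodic f T) (x y : ℝ) : f x = f y := by
  have key : ∀ x y, f y ≤ f x := by
    intro x y
    obtain ⟨n, hn⟩ := exists_nat_gt ((y - x) / T)
    rw [div_lt_iff₀ hT] at hn
    calc f y ≤ f (x + n * T) := hf (by linarith)
      _ = f x := (hp.nat_mul n) x
  exact le_antisymm (key y x) (key x y)

namespace IsPeriodicField

variable {R : ℝ × ℝ × ℝ → ℝ} {h₀ : ℝ}

/-- Uniqueness near a hyperbolic level: an orbit which is periodic and stays near `h₀` lies on the
graph of any given periodic solution near `h₀`. -/
lemma eq_of_periodic (hR : IsPeriodicField R h₀) {e η ρ μ : ℝ} (he : 0 < e)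
    (hμ : ∫ θ in (0 : ℝ)..2 * π, fieldSlope R h₀ θ = 2 * π * μ) (hη : η < |μ|)
    (hlin : ∀ h h' θ, |h - h₀| < ρ → |h' - h₀| < ρ →
      |R (e, h, θ) - R (e, h', θ) - fieldSlope R h₀ θ * (h - h')| ≤ η * |h - h'|)
    {β : ℝ → ℝ} (hβper : ∀ θ, β (θ + 2 * π) = β θ) (hβρ : ∀ θ, |β θ - h₀| < ρ)
    (hβ : ∀ θ, HasDerivAt β (e * R (e, β θ, θ)) θ)
    {Θ H w : ℝ → ℝ} {T : ℝ} {k : ℤ} (hT : 0 < T) (hΘ : ∀ t, HasDerivAt Θ (w t) t)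
    (hw : ∀ t, 0 < w t) (hH : ∀ t, HasDerivAt H (e * w t * R (e, H t, Θ t)) t)
    (hHρ : ∀ t, |H t - h₀| < ρ) (hHT : ∀ t, H (t + T) = H t)
    (hΘT : ∀ t, Θ (t + T) = Θ t + k * (2 * π)) (t : ℝ) : H t = β (Θ t) := by
  have hκ := hR.continuous_fieldSlope
  have hκμ : Continuous fun θ => fieldSlope R h₀ θ - μ := hκ.sub continuous_const
  set S : ℝ → ℝ := fun θ => ∫ s in (0 : ℝ)..θ, (fieldSlope R h₀ s - μ) with hS
  have hSd : ∀ θ, HasDerivAt S (fieldSlope R h₀ θ - μ) θ := fun θ =>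
    intervalIntegral.integral_hasDerivAt_right (hκμ.intervalIntegrable _ _)
      (hκμ.stronglyMeasurableAtFilter _ _) hκμ.continuousAt
  have hSper : Function.Periodic S (2 * π) := by
    intro θ
    have h1 := intervalIntegral.integral_add_adjacent_intervals
      (hκμ.intervalIntegrable (μ := MeasureTheory.volume) 0 θ)
      (hκμ.intervalIntegrable (μ := MeasureTheory.volume) θ (θ + 2 * π))
    have hp : Function.Periodic (fun θ => fieldSlope R h₀ θ - μ) (2 * π) := fun θ => by
      simp only [hR.fieldSlope_periodic]
    have h2 := hp.intervalIntegral_add_eq θ 0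
    have h3 : ∫ θ in (0 : ℝ)..2 * π, (fieldSlope R h₀ θ - μ) = 0 := by
      rw [intervalIntegral.integral_sub (hκ.intervalIntegrable _ _)
        (continuous_const.intervalIntegrable _ _), hμ, intervalIntegral.integral_const,
        sub_zero, smul_eq_mul, sub_self]
    rw [zero_add, h3] at h2
    simp only [hS, ← h1, h2, add_zero]
  set W : ℝ → ℝ := fun t => H t - β (Θ t) with hW
  set Z : ℝ → ℝ := fun t => μ * (W t ^ 2 * exp (-(2 * e * S (Θ t)))) with hZ
  have hWd : ∀ t, HasDerivAt W (e * w t * (R (e, H t, Θ t) - R (e, β (Θ t), Θ t))) t := by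
    intro t
    refine ((hH t).sub ((hβ (Θ t)).comp t (hΘ t))).congr_deriv ?_
    ring
  set D : ℝ → ℝ := fun t => 2 * e * w t * exp (-(2 * e * S (Θ t))) *
    (μ * W t * (R (e, H t, Θ t) - R (e, β (Θ t), Θ t) - fieldSlope R h₀ (Θ t) * W t)
      + μ ^ 2 * W t ^ 2) with hD
  have hZd : ∀ t, HasDerivAt Z (D t) t := by
    intro t
    have h1 := ((((hSd (Θ t)).comp t (hΘ t)).const_mul (2 * e)).neg).exp
    have h2 := (((hWd t).pow 2).mul h1).const_mul μ
    refine h2.congr_deriv ?_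
    simp only [hD, Function.comp_apply, Pi.pow_apply, Pi.neg_apply]
    push_cast
    ring
  have hDlow : ∀ t, 2 * e * w t * exp (-(2 * e * S (Θ t))) * ((|μ| * (|μ| - η)) * W t ^ 2) ≤ D t := by
    intro t
    have hpos : 0 ≤ 2 * e * w t * exp (-(2 * e * S (Θ t))) := by
      have := hw t; positivity
    refine mul_le_mul_of_nonneg_left ?_ hpos
    have h1 := hlin (H t) (β (Θ t)) (Θ t) (hHρ t) (hβρ _)
    change |_ - fieldSlope R h₀ (Θ t) * W t| ≤ η * |W t| at h1
    have h2 : |μ * W t * (R (e, H t, Θ t) - R (e, β (Θ t), Θ t) - fieldSlope R h₀ (Θ t) * W t)| ≤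
        |μ| * |W t| * (η * |W t|) := by
      rw [abs_mul, abs_mul]
      exact mul_le_mul_of_nonneg_left h1 (by positivity)
    have h3 := (abs_le.mp h2).1
    have h4 : |μ| ^ 2 = μ ^ 2 := sq_abs μ
    have h5 : |W t| ^ 2 = W t ^ 2 := sq_abs _
    have h6 : |μ| * |W t| * (η * |W t|) = |μ| * η * W t ^ 2 := by rw [← h5]; ring
    rw [h6] at h3
    have h7 : |μ| * (|μ| - η) * W t ^ 2 = μ ^ 2 * W t ^ 2 - |μ| * η * W t ^ 2 := by
      rw [← h4]; ring
    linarith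
  have hμ0 : 0 ≤ |μ| := abs_nonneg μ
  have hZmono : Monotone Z := by
    refine monotone_of_deriv_nonneg (fun t => (hZd t).differentiableAt) fun t => ?_
    rw [(hZd t).deriv]
    refine le_trans ?_ (hDlow t)
    have := hw t
    have h8 : 0 ≤ |μ| - η := by linarith
    positivity
  have hΘper : ∀ t, β (Θ (t + T)) = β (Θ t) ∧ S (Θ (t + T)) = S (Θ t) := by
    intro t
    rw [hΘT]
    exact ⟨(Function.Periodic.int_mul (f := β) hβper k) _, (hSper.int_mul k) _⟩
  have hZper : Function.Periodic Z T := by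
    intro t
    simp only [hZ, hW, hHT, hΘper]
  have hconst : Z = fun _ => Z 0 := funext fun t => hZmono.eq_of_periodic hT hZper t 0
  have hD0 : D t = 0 := by
    have := hZd t
    rw [hconst] at this
    exact this.unique (hasDerivAt_const t _)
  have h9 := hDlow t
  rw [hD0] at h9
  have hlt : 0 ≤ η ∨ η < 0 := le_or_gt 0 η
  have h10 : W t = 0 := by
    by_contra hne
    have hη0 : 0 ≤ η := by
      have h1 := hlin (H t) (β (Θ t)) (Θ t) (hHρ t) (hβρ _)
      have h2 : 0 < |H t - β (Θ t)| := abs_pos.mpr hne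
      by_contra hcon
      nlinarith [abs_nonneg (R (e, H t, Θ t) - R (e, β (Θ t), Θ t) -
        fieldSlope R h₀ (Θ t) * (H t - β (Θ t)))]
    have h8 : 0 < |μ| - η := by linarith
    have h11 : 0 < |μ| := by linarith
    have := hw t
    have h12 : 0 < W t ^ 2 := by positivity
    have : 0 < 2 * e * w t * exp (-(2 * e * S (Θ t))) * ((|μ| * (|μ| - η)) * W t ^ 2) := by
      positivity
    linarith
  exact sub_eq_zero.mp h10

end IsPeriodicField

end IsolatedPeriodic

section IsolatedPeriodicExistence

open Set Topology Real NNReal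

lemma exists_bound_of_periodic {f : ℝ → ℝ} (hf : Continuous f)
    (hper : ∀ θ, f (θ + 2 * π) = f θ) : ∃ C, 0 ≤ C ∧ ∀ θ, |f θ| ≤ C := by
  obtain ⟨C, hC⟩ := isCompact_Icc.exists_bound_of_continuousOn
    (hf.continuousOn (s := Icc 0 (2 * π)))
  have hC' : ∀ θ, |f θ| ≤ C := by
    intro θ
    obtain ⟨y, hy, hxy⟩ := Function.Periodic.exists_mem_Ico₀ hper (by positivity) θ
    rw [hxy]
    exact hC y ⟨hy.1, hy.2.le⟩
  exact ⟨C, (abs_nonneg _).trans (hC' 0), hC'⟩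

namespace IsPeriodicField

variable {R : ℝ × ℝ × ℝ → ℝ} {h₀ : ℝ}

lemma eventually_near_zero (hR : IsPeriodicField R h₀) {σ : ℝ} (hσ : 0 < σ) :
    ∀ᶠ e in 𝓝 (0 : ℝ), ∀ θ, |R (e, h₀, θ) - R (0, h₀, θ)| ≤ σ := by
  refine eventually_forall_of_periodic
    (P := fun e θ => |R (e, h₀, θ) - R (0, h₀, θ)| ≤ σ) ?_ ?_
  · intro e θ
    simp only [hR.periodic]
  · intro θ
    have h1 : ContinuousAt (fun z : ℝ × ℝ => R (z.1, h₀, z.2)) (0, θ) :=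
      ContinuousAt.comp (f := fun z : ℝ × ℝ => (z.1, h₀, z.2)) (g := R)
        (hR.contDiffAt θ).continuousAt (by fun_prop)
    have h2 : ContinuousAt (fun z : ℝ × ℝ => R (0, h₀, z.2)) (0, θ) :=
      ContinuousAt.comp (f := fun z : ℝ × ℝ => ((0 : ℝ), h₀, z.2)) (g := R)
        (hR.contDiffAt θ).continuousAt (by fun_prop)
    have h3 := (h1.sub h2).abs.eventually_lt_const (u := σ) (by simpa using hσ)
    filter_upwards [h3] with z hz using hz.le

/-- A simple zero of the averaged equation produces, for small parameters, a periodic solution of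
`h' = e R (e, h, θ)` near `h₀`, which is the only periodic orbit nearby. -/
theorem eventually_exists_isolated (hR : IsPeriodicField R h₀)
    (h0 : ∫ θ in (0 : ℝ)..2 * π, R (0, h₀, θ) = 0)
    (h1 : ∫ θ in (0 : ℝ)..2 * π, fieldSlope R h₀ θ ≠ 0) :
    ∀ᶠ ρ in 𝓝[>] (0 : ℝ), ∀ᶠ e in 𝓝[>] (0 : ℝ), ∃ β : ℝ → ℝ,
      (∀ θ, β (θ + 2 * π) = β θ) ∧ (∀ θ, |β θ - h₀| < ρ) ∧
      (∀ θ, HasDerivAt β (e * R (e, β θ, θ)) θ) ∧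
      ∀ (Θ H w : ℝ → ℝ) (T : ℝ) (k : ℤ), 0 < T → (∀ t, HasDerivAt Θ (w t) t) →
        (∀ t, 0 < w t) → (∀ t, HasDerivAt H (e * w t * R (e, H t, Θ t)) t) →
        (∀ t, |H t - h₀| < ρ) → (∀ t, H (t + T) = H t) →
        (∀ t, Θ (t + T) = Θ t + k * (2 * π)) → ∀ t, H t = β (Θ t) := by
  have hpi := Real.two_pi_pos
  obtain ⟨μ, hμ⟩ : ∃ μ, ∫ θ in (0 : ℝ)..2 * π, fieldSlope R h₀ θ = 2 * π * μ :=
    ⟨(∫ θ in (0 : ℝ)..2 * π, fieldSlope R h₀ θ) / (2 * π), by field_simp⟩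
  have hμ0 : 0 < |μ| := abs_pos.mpr (by rintro rfl; simp [hμ] at h1)
  obtain ⟨K, hK0, hK⟩ := exists_bound_of_periodic hR.continuous_fieldSlope hR.fieldSlope_periodic
  have hc0 := hR.eventually_continuous_slice.self_of_nhds
  obtain ⟨C, hC0, hC⟩ := exists_bound_of_periodic hc0 (hR.periodic 0 h₀)
  obtain ⟨δ₁, hδ₁, hlin₁⟩ := Metric.eventually_nhds_iff.mp
    (hR.eventually_linearized (η := |μ| / 8) (by positivity))
  obtain ⟨δ₂, hδ₂, hcd₂⟩ := Metric.eventually_nhds_iff.mp hR.eventually_continuousAt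
  filter_upwards [Ioo_mem_nhdsGT (lt_min hδ₁ hδ₂)] with ρ hρ
  have hρ0 : 0 < ρ := hρ.1
  have hσ : 0 < |μ| * ρ / 8 := by positivity
  set C' : ℝ := C + |μ| * ρ / 8 + (K + |μ| / 8) * ρ with hC'
  have hC'0 : 0 ≤ C' := by positivity
  have hev1 : ∀ᶠ e in 𝓝 (0 : ℝ), e * C' * (2 * π) < ρ / 4 := by
    have : Continuous fun e : ℝ => e * C' * (2 * π) := by fun_prop
    exact this.continuousAt.eventually_lt_const (by simpa using hρ0)
  have hev2 : ∀ᶠ e in 𝓝 (0 : ℝ), K * (e * C' * (2 * π)) < |μ| * ρ / 8 := by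
    have : Continuous fun e : ℝ => K * (e * C' * (2 * π)) := by fun_prop
    exact this.continuousAt.eventually_lt_const (by simpa using hσ)
  filter_upwards [Ioo_mem_nhdsGT hρ0, nhdsWithin_le_nhds hev1, nhdsWithin_le_nhds hev2,
    nhdsWithin_le_nhds (hR.eventually_near_zero hσ)] with e he he1 he2 hnear
  have he0 : 0 < e := he.1
  have hlin : ∀ h h' θ, |h - h₀| < ρ → |h' - h₀| < ρ →
      |R (e, h, θ) - R (e, h', θ) - fieldSlope R h₀ θ * (h - h')| ≤ |μ| / 8 * |h - h'| := by
    intro h h' θ hh hh'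
    refine hlin₁ (y := (e, h, h')) ?_ θ
    have hm : ρ < δ₁ := hρ.2.trans_le (min_le_left _ _)
    simp only [Prod.dist_eq, Real.dist_eq, sub_zero, max_lt_iff, abs_of_pos he0]
    exact ⟨he.2.trans hm, hh.trans hm, hh'.trans hm⟩
  have hcd : ∀ h θ, |h - h₀| < ρ → ContinuousAt R (e, h, θ) := by
    intro h θ hh
    have hm : ρ < δ₂ := hρ.2.trans_le (min_le_right _ _)
    refine (hcd₂ (y := (e, h)) ?_ θ).continuousAt
    simp only [Prod.dist_eq, Real.dist_eq, sub_zero, max_lt_iff, abs_of_pos he0]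
    exact ⟨he.2.trans hm, hh.trans hm⟩
  have hLipR : ∀ h h' θ, |h - h₀| < ρ → |h' - h₀| < ρ →
      |R (e, h, θ) - R (e, h', θ)| ≤ (K + |μ| / 8) * |h - h'| := by
    intro h h' θ hh hh'
    have e1 : R (e, h, θ) - R (e, h', θ) = (R (e, h, θ) - R (e, h', θ) -
      fieldSlope R h₀ θ * (h - h')) + fieldSlope R h₀ θ * (h - h') := by ring
    rw [e1]
    refine (abs_add_le _ _).trans ?_
    rw [abs_mul (fieldSlope R h₀ θ)]
    have := hlin h h' θ hh hh'
    have := mul_le_mul_of_nonneg_right (hK θ) (abs_nonneg (h - h'))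
    linarith
  have hbd : ∀ h θ, |h - h₀| < ρ → |R (e, h, θ)| ≤ C' := by
    intro h θ hh
    have e1 : R (e, h, θ) = (R (e, h, θ) - R (e, h₀, θ)) + (R (e, h₀, θ) - R (0, h₀, θ)) +
      R (0, h₀, θ) := by ring
    rw [e1]
    have a1 := hLipR h h₀ θ hh (by simpa using hρ0)
    have a2 : (K + |μ| / 8) * |h - h₀| ≤ (K + |μ| / 8) * ρ := by gcongr
    have a3 := hnear θ
    have a4 := hC θ
    refine (abs_add_three _ _ _).trans ?_
    linarith
  set cl : ℝ → ℝ := fun x => max (h₀ - 3 * ρ / 4) (min (h₀ + 3 * ρ / 4) x) with hcl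
  have hcl1 : ∀ x, |cl x - h₀| < ρ := by
    intro x
    have b1 : h₀ - 3 * ρ / 4 ≤ cl x := le_max_left _ _
    have b2 : cl x ≤ h₀ + 3 * ρ / 4 := max_le (by linarith) (min_le_left _ _)
    rw [abs_lt]; constructor <;> linarith
  have hcl2 : ∀ x, h₀ - 3 * ρ / 4 ≤ x → x ≤ h₀ + 3 * ρ / 4 → cl x = x := by
    intro x h1 h2
    simp only [hcl]
    rw [min_eq_right h2, max_eq_right h1]
  have hcl3 : ∀ x y, |cl x - cl y| ≤ |x - y| := by
    intro x y
    simp only [hcl]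
    refine (abs_max_sub_max_le_max _ _ _ _).trans ?_
    rw [sub_self, abs_zero, max_eq_right (abs_nonneg _)]
    refine (abs_min_sub_min_le_max _ _ _ _).trans ?_
    rw [sub_self, abs_zero, max_eq_right (abs_nonneg _)]
  have hclc : Continuous cl := by simp only [hcl]; fun_prop
  set F : ℝ → ℝ → ℝ := fun θ x => e * R (e, cl x, θ) with hF
  have hcont : Continuous (Function.uncurry F) := by
    refine continuous_const.mul (continuous_iff_continuousAt.mpr ?_)
    rintro ⟨θ, x⟩
    exact ContinuousAt.comp (f := fun z : ℝ × ℝ => (e, cl z.2, z.1)) (g := R)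
      (hcd (cl x) θ (hcl1 x)) (by fun_prop)
  obtain ⟨L, hLv⟩ : ∃ L : ℝ≥0, (L : ℝ) = e * C' := ⟨⟨_, by positivity⟩, rfl⟩
  obtain ⟨M, hM⟩ : ∃ M : ℝ≥0, (M : ℝ) = e * (K + |μ| / 8) := ⟨⟨_, by positivity⟩, rfl⟩
  have hlip : ∀ θ, LipschitzWith M (F θ) := by
    intro θ
    refine LipschitzWith.of_dist_le_mul fun x y => ?_
    simp only [Real.dist_eq, hF, hM]
    rw [← mul_sub, abs_mul, abs_of_pos he0, mul_assoc]
    refine mul_le_mul_of_nonneg_left ((hLipR _ _ θ (hcl1 x) (hcl1 y)).trans ?_) he0.le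
    exact mul_le_mul_of_nonneg_left (hcl3 x y) (by positivity)
  have hsign : ∀ (c : ℝ), |c - h₀| = ρ / 2 → ∀ α : ℝ → ℝ, ContinuousOn α (Icc 0 (2 * π)) →
      (∀ θ ∈ Icc 0 (2 * π), |α θ - c| ≤ L * (2 * π)) →
      |(∫ θ in (0 : ℝ)..2 * π, F θ (α θ)) - e * (2 * π * μ * (c - h₀))| ≤
        e * (2 * π * (|μ| * ρ / 2)) := by
    intro c hc α hαc hα
    have hi1 : IntervalIntegrable (fun θ => F θ (α θ)) MeasureTheory.volume 0 (2 * π) := by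
      refine ContinuousOn.intervalIntegrable ?_
      rw [uIcc_of_le hpi.le]
      exact hcont.comp_continuousOn (f := fun θ => (θ, α θ)) (continuousOn_id.prodMk hαc)
    have hi2 : Continuous fun θ => R (0, h₀, θ) + fieldSlope R h₀ θ * (c - h₀) :=
      hc0.add (hR.continuous_fieldSlope.mul_const _)
    have e1 : (∫ θ in (0 : ℝ)..2 * π, F θ (α θ)) - e * (2 * π * μ * (c - h₀)) =
        ∫ θ in (0 : ℝ)..2 * π,
          (F θ (α θ) - e * (R (0, h₀, θ) + fieldSlope R h₀ θ * (c - h₀))) := by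
      have hi3 : Continuous fun θ => e * (R (0, h₀, θ) + fieldSlope R h₀ θ * (c - h₀)) :=
        continuous_const.mul hi2
      rw [intervalIntegral.integral_sub hi1 (hi3.intervalIntegrable _ _),
        intervalIntegral.integral_const_mul e (fun θ => R (0, h₀, θ) + fieldSlope R h₀ θ * (c - h₀)),
        intervalIntegral.integral_add
          (hc0.intervalIntegrable _ _)
          ((hR.continuous_fieldSlope.mul_const _).intervalIntegrable _ _),
        intervalIntegral.integral_mul_const, h0, hμ, zero_add]
    rw [e1, ← Real.norm_eq_abs]
    refine (intervalIntegral.norm_integral_le_of_norm_le_const (C := e * (|μ| * ρ / 2))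
      fun θ hθ => ?_).trans (le_of_eq (by rw [sub_zero, abs_of_pos hpi]; ring_nf : e * (|μ| * ρ / 2) * |2 * π - 0| = e * (2 * π * (|μ| * ρ / 2))))
    rw [uIoc_of_le hpi.le] at hθ
    have hαθ := hα θ ⟨hθ.1.le, hθ.2⟩
    rw [hLv] at hαθ
    obtain ⟨b1, b2⟩ := abs_le.mp hαθ
    obtain ⟨b3, b4⟩ := abs_le.mp hc.le
    have hcla : cl (α θ) = α θ := hcl2 _ (by linarith) (by linarith)
    have hαh : |α θ - h₀| ≤ 3 * ρ / 4 := by rw [abs_le]; constructor <;> linarith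
    have e2 : F θ (α θ) - e * (R (0, h₀, θ) + fieldSlope R h₀ θ * (c - h₀)) =
      e * ((R (e, α θ, θ) - R (e, h₀, θ) - fieldSlope R h₀ θ * (α θ - h₀)) +
        (R (e, h₀, θ) - R (0, h₀, θ)) + fieldSlope R h₀ θ * (α θ - c)) := by
      simp only [hF, hcla]; ring
    rw [e2, Real.norm_eq_abs, abs_mul, abs_of_pos he0]
    refine mul_le_mul_of_nonneg_left ((abs_add_three _ _ _).trans ?_) he0.le
    have a1 := hlin (α θ) h₀ θ (by linarith) (by simpa using hρ0)
    have a2 : |μ| / 8 * |α θ - h₀| ≤ |μ| / 8 * (3 * ρ / 4) := by gcongr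
    have a3 := hnear θ
    have a4 : |fieldSlope R h₀ θ * (α θ - c)| ≤ K * (e * C' * (2 * π)) := by
      rw [abs_mul]; exact mul_le_mul (hK θ) hαθ (abs_nonneg _) hK0
    nlinarith [mul_pos hμ0 hρ0]
  have hμsq : |μ| * |μ| = μ * μ := abs_mul_abs_self μ
  obtain ⟨β, hβper, hβd, hβ⟩ := exists_periodic_of_sign (F := F) (L := L) (c := h₀ - ρ / 2)
    (d := h₀ + ρ / 2) (s := μ) hpi
    (fun θ x => by simp only [hF, hR.periodic]) hcont hlip
    (fun θ x => by
      simp only [hF, hLv]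
      rw [abs_mul, abs_of_pos he0]
      exact mul_le_mul_of_nonneg_left (hbd _ _ (hcl1 x)) he0.le)
    (by linarith) (abs_pos.mp hμ0)
    (fun α hαc hα => by
      have h := hsign (h₀ - ρ / 2) (by rw [sub_sub_cancel_left, abs_neg, abs_of_pos (by positivity)])
        α hαc hα
      set I := ∫ θ in (0 : ℝ)..2 * π, F θ (α θ)
      have h2 := mul_le_mul_of_nonneg_left h hμ0.le
      rw [← abs_mul] at h2
      have h3 := (abs_le.mp h2).2
      have h4 : μ * (e * (2 * π * μ * (h₀ - ρ / 2 - h₀))) = - (e * (2 * π) * (ρ / 2) * (μ * μ)) := by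
        ring
      have h5 : |μ| * (e * (2 * π * (|μ| * ρ / 2))) = e * (2 * π) * (ρ / 2) * (|μ| * |μ|) := by ring
      rw [mul_sub, h4, h5, hμsq] at h3
      linarith)
    (fun α hαc hα => by
      have h := hsign (h₀ + ρ / 2) (by rw [add_sub_cancel_left, abs_of_pos (by positivity)])
        α hαc hα
      set I := ∫ θ in (0 : ℝ)..2 * π, F θ (α θ)
      have h2 := mul_le_mul_of_nonneg_left h hμ0.le
      rw [← abs_mul] at h2
      have h3 := (abs_le.mp h2).1
      have h4 : μ * (e * (2 * π * μ * (h₀ + ρ / 2 - h₀))) = (e * (2 * π) * (ρ / 2) * (μ * μ)) := by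
        ring
      have h5 : |μ| * (e * (2 * π * (|μ| * ρ / 2))) = e * (2 * π) * (ρ / 2) * (|μ| * |μ|) := by ring
      rw [mul_sub, h4, h5, hμsq] at h3
      linarith)
  have hβ1 : ∀ θ, h₀ - 3 * ρ / 4 ≤ β θ ∧ β θ ≤ h₀ + 3 * ρ / 4 := by
    intro θ
    have := hβ θ
    rw [hLv] at this
    constructor <;> linarith [this.1, this.2]
  have hβρ : ∀ θ, |β θ - h₀| < ρ := by
    intro θ
    have := hβ1 θ
    rw [abs_lt]
    constructor <;> linarith [this.1, this.2]
  have hβd' : ∀ θ, HasDerivAt β (e * R (e, β θ, θ)) θ := by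
    intro θ
    have := hβd θ
    simp only [hF] at this
    rwa [hcl2 _ (hβ1 θ).1 (hβ1 θ).2] at this
  refine ⟨β, hβper, hβρ, hβd', ?_⟩
  intro Θ H w T k hT hΘ hw hH hHρ hHT hΘT
  exact hR.eq_of_periodic he0 hμ (by linarith) hlin hβper hβρ hβd' hT hΘ hw hH hHρ hHT hΘT

end IsPeriodicField

end IsolatedPeriodicExistence

section OvalChart

open Set Topology Real

/-- Coordinates `x = A h + B h * cos θ`, `y = - B h * sin θ * Q (x, h)` on a family of ovals
`y ^ 2 / 2 + G x = h`, with `h` in the open set `J`. -/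
structure IsOvalChart (G : ℝ[X]) (A B : ℝ → ℝ) (Q : ℝ × ℝ → ℝ) (J : Set ℝ) : Prop where
  isOpen : IsOpen J
  B_pos : ∀ h ∈ J, 0 < B h
  contDiffAt_A : ∀ h ∈ J, ContDiffAt ℝ 2 A h
  contDiffAt_B : ∀ h ∈ J, ContDiffAt ℝ 2 B h
  Q_pos : ∀ h ∈ J, ∀ x, |x - A h| ≤ B h → 0 < Q (x, h)
  contDiffAt_Q : ∀ h ∈ J, ∀ x, |x - A h| ≤ B h → ContDiffAt ℝ 1 Q (x, h)
  level : ∀ h ∈ J, ∀ x, |x - A h| ≤ B h →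
    2 * (h - G.eval x) = (B h ^ 2 - (x - A h) ^ 2) * Q (x, h) ^ 2
  right : ∀ h ∈ J, (derivative G).eval (A h + B h) = B h * Q (A h + B h, h) ^ 2
  left : ∀ h ∈ J, (derivative G).eval (A h - B h) = -(B h * Q (A h - B h, h) ^ 2)

/-- The angular speed in oval coordinates. -/
noncomputable def ovalSpeed (f : ℝ[X]) (A B : ℝ → ℝ) (Q : ℝ × ℝ → ℝ) (p : ℝ × ℝ × ℝ) : ℝ :=
  Q (A p.2.1 + B p.2.1 * cos p.2.2, p.2.1) -
    p.1 * (deriv A p.2.1 + deriv B p.2.1 * cos p.2.2) *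
      f.eval (A p.2.1 + B p.2.1 * cos p.2.2) * B p.2.1 * sin p.2.2 *
        Q (A p.2.1 + B p.2.1 * cos p.2.2, p.2.1) ^ 2

/-- The function `R` such that orbits of the Liénard system satisfy `dh/dθ = ε R (ε, h, θ)`. -/
noncomputable def ovalField (f : ℝ[X]) (A B : ℝ → ℝ) (Q : ℝ × ℝ → ℝ) (p : ℝ × ℝ × ℝ) : ℝ :=
  -(f.eval (A p.2.1 + B p.2.1 * cos p.2.2) * (B p.2.1 * sin p.2.2 *
    Q (A p.2.1 + B p.2.1 * cos p.2.2, p.2.1)) ^ 2) / ovalSpeed f A B Q p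

namespace IsOvalChart

variable {G f : ℝ[X]} {A B : ℝ → ℝ} {Q : ℝ × ℝ → ℝ} {J : Set ℝ} {h₀ : ℝ}

lemma abs_param_le (hc : IsOvalChart G A B Q J) {h : ℝ} (hh : h ∈ J) (θ : ℝ) :
    |A h + B h * cos θ - A h| ≤ B h := by
  rw [add_sub_cancel_left, abs_mul, abs_of_pos (hc.B_pos h hh)]
  exact mul_le_of_le_one_right (hc.B_pos h hh).le (abs_cos_le_one θ)

lemma contDiffAt_eval (f : ℝ[X]) (x : ℝ) {n : WithTop ℕ∞} :
    ContDiffAt ℝ n (fun x => f.eval x) x := by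
  have := (f.contDiff_aeval (𝕜 := ℝ) n).contDiffAt (x := x)
  simpa using this

lemma contDiffAt_deriv {A : ℝ → ℝ} {h : ℝ} (hA : ContDiffAt ℝ 2 A h) :
    ContDiffAt ℝ 1 (deriv A) h := by
  have h1 : ContDiffAt ℝ 1 (fderiv ℝ A) h := hA.fderiv_right (m := 1) (by norm_num)
  exact h1.clm_apply contDiffAt_const

lemma contDiffAt_param (hc : IsOvalChart G A B Q J) (hh : h₀ ∈ J) (e θ : ℝ) :
    ContDiffAt ℝ 1 (fun p : ℝ × ℝ × ℝ => A p.2.1 + B p.2.1 * cos p.2.2) (e, h₀, θ) := by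
  have h1 : ContDiffAt ℝ 1 (fun p : ℝ × ℝ × ℝ => p.2.1) (e, h₀, θ) := by fun_prop
  have h2 : ContDiffAt ℝ 1 (fun p : ℝ × ℝ × ℝ => cos p.2.2) (e, h₀, θ) := by fun_prop
  have h3 : ContDiffAt ℝ 1 (fun p : ℝ × ℝ × ℝ => A p.2.1) (e, h₀, θ) :=
    ContDiffAt.comp (e, h₀, θ) (g := A) ((hc.contDiffAt_A h₀ hh).of_le (by norm_num)) h1
  have h4 : ContDiffAt ℝ 1 (fun p : ℝ × ℝ × ℝ => B p.2.1) (e, h₀, θ) :=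
    ContDiffAt.comp (e, h₀, θ) (g := B) ((hc.contDiffAt_B h₀ hh).of_le (by norm_num)) h1
  exact h3.add (h4.mul h2)

lemma contDiffAt_Q_param (hc : IsOvalChart G A B Q J) (hh : h₀ ∈ J) (e θ : ℝ) :
    ContDiffAt ℝ 1 (fun p : ℝ × ℝ × ℝ => Q (A p.2.1 + B p.2.1 * cos p.2.2, p.2.1))
      (e, h₀, θ) := by
  have h1 : ContDiffAt ℝ 1 (fun p : ℝ × ℝ × ℝ => p.2.1) (e, h₀, θ) := by fun_prop
  exact ContDiffAt.comp (e, h₀, θ) (g := Q)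
    (f := fun p : ℝ × ℝ × ℝ => (A p.2.1 + B p.2.1 * cos p.2.2, p.2.1))
    (hc.contDiffAt_Q h₀ hh _ (hc.abs_param_le hh θ)) ((hc.contDiffAt_param hh e θ).prodMk h1)

lemma contDiffAt_ovalSpeed (hc : IsOvalChart G A B Q J) (hh : h₀ ∈ J) (e θ : ℝ) :
    ContDiffAt ℝ 1 (ovalSpeed f A B Q) (e, h₀, θ) := by
  have h1 : ContDiffAt ℝ 1 (fun p : ℝ × ℝ × ℝ => p.2.1) (e, h₀, θ) := by fun_prop
  have h2 : ContDiffAt ℝ 1 (fun p : ℝ × ℝ × ℝ => cos p.2.2) (e, h₀, θ) := by fun_prop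
  have h2' : ContDiffAt ℝ 1 (fun p : ℝ × ℝ × ℝ => sin p.2.2) (e, h₀, θ) := by fun_prop
  have h0 : ContDiffAt ℝ 1 (fun p : ℝ × ℝ × ℝ => p.1) (e, h₀, θ) := by fun_prop
  have h3 : ContDiffAt ℝ 1 (fun p : ℝ × ℝ × ℝ => deriv A p.2.1) (e, h₀, θ) :=
    ContDiffAt.comp (e, h₀, θ) (g := deriv A) (contDiffAt_deriv (hc.contDiffAt_A h₀ hh)) h1
  have h3' : ContDiffAt ℝ 1 (fun p : ℝ × ℝ × ℝ => deriv B p.2.1) (e, h₀, θ) :=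
    ContDiffAt.comp (e, h₀, θ) (g := deriv B) (contDiffAt_deriv (hc.contDiffAt_B h₀ hh)) h1
  have h4 : ContDiffAt ℝ 1 (fun p : ℝ × ℝ × ℝ => B p.2.1) (e, h₀, θ) :=
    ContDiffAt.comp (e, h₀, θ) (g := B) ((hc.contDiffAt_B h₀ hh).of_le (by norm_num)) h1
  have h5 := hc.contDiffAt_param hh e θ
  have h6 := hc.contDiffAt_Q_param hh e θ
  have h7 : ContDiffAt ℝ 1
      (fun p : ℝ × ℝ × ℝ => f.eval (A p.2.1 + B p.2.1 * cos p.2.2)) (e, h₀, θ) :=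
    ContDiffAt.comp (e, h₀, θ) (g := fun x => f.eval x) (contDiffAt_eval f _) h5
  exact h6.sub (((((h0.mul (h3.add (h3'.mul h2))).mul h7).mul h4).mul h2').mul (h6.pow 2))

lemma ovalSpeed_zero (h θ : ℝ) :
    ovalSpeed f A B Q (0, h, θ) = Q (A h + B h * cos θ, h) := by
  simp [ovalSpeed]

lemma isPeriodicField (hc : IsOvalChart G A B Q J) (hh : h₀ ∈ J) :
    IsPeriodicField (ovalField f A B Q) h₀ where
  periodic e h θ := by simp only [ovalField, ovalSpeed, cos_add_two_pi, sin_add_two_pi]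
  contDiffAt θ := by
    have h1 : ContDiffAt ℝ 1 (fun p : ℝ × ℝ × ℝ => p.2.1) (0, h₀, θ) := by fun_prop
    have h2' : ContDiffAt ℝ 1 (fun p : ℝ × ℝ × ℝ => sin p.2.2) (0, h₀, θ) := by fun_prop
    have h4 : ContDiffAt ℝ 1 (fun p : ℝ × ℝ × ℝ => B p.2.1) (0, h₀, θ) :=
      ContDiffAt.comp (0, h₀, θ) (g := B) ((hc.contDiffAt_B h₀ hh).of_le (by norm_num)) h1
    have h5 := hc.contDiffAt_param hh 0 θ
    have h6 := hc.contDiffAt_Q_param hh 0 θ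
    have h7 : ContDiffAt ℝ 1
        (fun p : ℝ × ℝ × ℝ => f.eval (A p.2.1 + B p.2.1 * cos p.2.2)) (0, h₀, θ) :=
      ContDiffAt.comp (0, h₀, θ) (g := fun x => f.eval x) (contDiffAt_eval f _) h5
    refine (h7.mul (((h4.mul h2').mul h6).pow 2)).neg.div (hc.contDiffAt_ovalSpeed hh 0 θ) ?_
    rw [ovalSpeed_zero]
    exact (hc.Q_pos h₀ hh _ (hc.abs_param_le hh θ)).ne'

lemma eventually_ovalSpeed_pos (hc : IsOvalChart G A B Q J) (hh : h₀ ∈ J) :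
    ∀ᶠ q : ℝ × ℝ in 𝓝 (0, h₀), ∀ θ, 0 < ovalSpeed f A B Q (q.1, q.2, θ) := by
  refine eventually_forall_of_periodic
    (P := fun (q : ℝ × ℝ) θ => 0 < ovalSpeed f A B Q (q.1, q.2, θ)) ?_ ?_
  · intro q θ
    simp only [ovalSpeed, cos_add_two_pi, sin_add_two_pi]
  · intro θ
    have h1 : ContinuousAt (fun z : (ℝ × ℝ) × ℝ => ovalSpeed f A B Q (z.1.1, z.1.2, z.2))
        ((0, h₀), θ) :=
      ContinuousAt.comp (f := fun z : (ℝ × ℝ) × ℝ => (z.1.1, z.1.2, z.2))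
        (g := ovalSpeed f A B Q) (hc.contDiffAt_ovalSpeed hh 0 θ).continuousAt (by fun_prop)
    refine h1.eventually_const_lt ?_
    beta_reduce
    rw [ovalSpeed_zero]
    exact hc.Q_pos h₀ hh _ (hc.abs_param_le hh θ)

/-- The average of the oval field is the integral of `-f` over the region bounded by the oval. -/
lemma integral_ovalField (hc : IsOvalChart G A B Q J) (hh : h₀ ∈ J) :
    ∫ θ in (0 : ℝ)..2 * π, ovalField f A B Q (0, h₀, θ) =
      -2 * ∫ x in (A h₀ - B h₀)..(A h₀ + B h₀), f.eval x * √(2 * (h₀ - G.eval x)) := by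
  have hB := hc.B_pos h₀ hh
  set φ : ℝ → ℝ := fun x => f.eval x * √(2 * (h₀ - G.eval x)) with hφ
  have hφc : Continuous φ := by simp only [hφ]; fun_prop
  have hX : ∀ θ, HasDerivAt (fun θ => A h₀ + B h₀ * cos θ) (B h₀ * -sin θ) θ := fun θ =>
    ((hasDerivAt_cos θ).const_mul (B h₀)).const_add (A h₀)
  have hval : ∀ θ, φ (A h₀ + B h₀ * cos θ) = f.eval (A h₀ + B h₀ * cos θ) *
      (B h₀ * |sin θ| * Q (A h₀ + B h₀ * cos θ, h₀)) := by
    intro θ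
    have hQ := hc.Q_pos h₀ hh _ (hc.abs_param_le hh θ)
    simp only [hφ]
    rw [hc.level h₀ hh _ (hc.abs_param_le hh θ)]
    congr 1
    rw [← Real.sqrt_sq (show 0 ≤ B h₀ * |sin θ| * Q (A h₀ + B h₀ * cos θ, h₀) by positivity)]
    congr 1
    rw [mul_pow, mul_pow, sq_abs, sin_sq]
    ring
  have hR : ∀ θ, ovalField f A B Q (0, h₀, θ) = -(f.eval (A h₀ + B h₀ * cos θ) *
      ((B h₀ * sin θ) ^ 2 * Q (A h₀ + B h₀ * cos θ, h₀))) := by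
    intro θ
    have hQ := hc.Q_pos h₀ hh _ (hc.abs_param_le hh θ)
    simp only [ovalField, ovalSpeed_zero]
    field_simp
  have hcont : Continuous fun θ => φ (A h₀ + B h₀ * cos θ) * (B h₀ * -sin θ) := by fun_prop
  have hsub : ∀ s t : ℝ, ∫ θ in s..t, φ (A h₀ + B h₀ * cos θ) * (B h₀ * -sin θ) =
      ∫ x in (A h₀ + B h₀ * cos s)..(A h₀ + B h₀ * cos t), φ x := fun s t =>
    intervalIntegral.integral_comp_mul_deriv (f := fun θ => A h₀ + B h₀ * cos θ)
      (f' := fun θ => B h₀ * -sin θ) (g := φ) (fun θ _ => hX θ) (by fun_prop) hφc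
  have hRc := (hc.isPeriodicField (f := f) hh).eventually_continuous_slice.self_of_nhds
  rw [← intervalIntegral.integral_add_adjacent_intervals (hRc.intervalIntegrable 0 π)
    (hRc.intervalIntegrable π (2 * π))]
  have i1 : ∫ θ in (0 : ℝ)..π, ovalField f A B Q (0, h₀, θ) =
      ∫ θ in (0 : ℝ)..π, φ (A h₀ + B h₀ * cos θ) * (B h₀ * -sin θ) := by
    refine intervalIntegral.integral_congr fun θ hθ => ?_
    rw [uIcc_of_le pi_pos.le] at hθ
    have hs : 0 ≤ sin θ := sin_nonneg_of_nonneg_of_le_pi hθ.1 hθ.2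
    simp only [hR, hval, abs_of_nonneg hs]
    ring
  have i2 : ∫ θ in π..2 * π, ovalField f A B Q (0, h₀, θ) =
      -∫ θ in π..2 * π, φ (A h₀ + B h₀ * cos θ) * (B h₀ * -sin θ) := by
    rw [← intervalIntegral.integral_neg]
    refine intervalIntegral.integral_congr fun θ hθ => ?_
    rw [uIcc_of_le (by linarith [pi_pos])] at hθ
    have hs : sin θ ≤ 0 := by
      have : 0 ≤ sin (θ - π) :=
        sin_nonneg_of_nonneg_of_le_pi (by linarith [hθ.1]) (by linarith [hθ.2])
      rw [sin_sub_pi] at this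
      linarith
    simp only [hR, hval, abs_of_nonpos hs]
    ring
  rw [i1, i2, hsub, hsub]
  simp only [cos_zero, cos_pi, cos_two_pi, mul_one, mul_neg, ← sub_eq_add_neg]
  rw [intervalIntegral.integral_symm (A h₀ - B h₀) (A h₀ + B h₀)]
  ring

end IsOvalChart

end OvalChart

section AngularLift

open Set Topology Real

lemma Continuous.surjective_of_add_period {θ : ℝ → ℝ} (hθ : Continuous θ) {T c : ℝ} (hc : 0 < c)
    (h : ∀ t, θ (t + T) = θ t + c) : Function.Surjective θ := by
  have hn : ∀ (n : ℕ) t, θ (t + n * T) = θ t + n * c := by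
    intro n
    induction n with
    | zero => simp
    | succ n ih =>
      intro t
      have : t + (n + 1 : ℕ) * T = (t + n * T) + T := by push_cast; ring
      rw [this, h, ih]
      push_cast; ring
  intro y
  obtain ⟨n, hny⟩ := exists_nat_gt (|y - θ 0| / c)
  rw [div_lt_iff₀ hc] at hny
  obtain ⟨h1, h2⟩ := abs_lt.mp hny
  refine mem_range_of_exists_le_of_exists_ge hθ ⟨-(n * T), ?_⟩ ⟨0 + n * T, ?_⟩
  · have := hn n (-(n * T))
    rw [neg_add_cancel] at this
    linarith
  · rw [hn]; linarith

lemma exists_time_change {w : ℝ → ℝ} (hw : Continuous w) (hpos : ∀ θ, 0 < w θ)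
    (hper : ∀ θ, w (θ + 2 * π) = w θ) :
    ∃ (Θ : ℝ → ℝ) (T : ℝ), 0 < T ∧ (∀ t, HasDerivAt Θ (w (Θ t)) t) ∧
      (∀ t, Θ (t + T) = Θ t + 2 * π) := by
  have hwi : Continuous fun θ => (w θ)⁻¹ := hw.inv₀ fun θ => (hpos θ).ne'
  set τ : ℝ → ℝ := fun θ => ∫ s in (0 : ℝ)..θ, (w s)⁻¹ with hτ
  have hτd : ∀ θ, HasDerivAt τ (w θ)⁻¹ θ := fun θ =>
    intervalIntegral.integral_hasDerivAt_right (hwi.intervalIntegrable _ _)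
      (hwi.stronglyMeasurableAtFilter _ _) hwi.continuousAt
  have hmono : StrictMono τ := strictMono_of_deriv_pos fun θ => by
    rw [(hτd θ).deriv]; exact inv_pos.mpr (hpos θ)
  have hT : 0 < τ (2 * π) := by
    have h0 : τ 0 = 0 := by simp [hτ]
    rw [← h0]; exact hmono Real.two_pi_pos
  have hτc : Continuous τ := continuous_iff_continuousAt.mpr fun θ => (hτd θ).continuousAt
  have hτp : ∀ θ, τ (θ + 2 * π) = τ θ + τ (2 * π) := by
    intro θ
    have h1 := intervalIntegral.integral_add_adjacent_intervals
      (hwi.intervalIntegrable (μ := MeasureTheory.volume) 0 θ)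
      (hwi.intervalIntegrable (μ := MeasureTheory.volume) θ (θ + 2 * π))
    have hp : Function.Periodic (fun θ => (w θ)⁻¹) (2 * π) := fun θ => by simp only [hper]
    have h2 := hp.intervalIntegral_add_eq θ 0
    rw [zero_add] at h2
    simp only [hτ, ← h1, h2]
  have hsurj := hτc.surjective_of_add_period hT hτp
  set o := hmono.orderIsoOfSurjective τ hsurj with ho
  have hoτ : ∀ θ, o θ = τ θ := fun θ => rfl
  refine ⟨o.symm, τ (2 * π), hT, fun t => ?_, fun t => ?_⟩
  · have h1 := hτd (o.symm t)
    have h2 : ContinuousAt o.symm t := o.symm.continuous.continuousAt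
    have h3 := HasDerivAt.of_local_left_inverse h2 h1 (inv_ne_zero (hpos _).ne')
      (Eventually.of_forall fun y => o.apply_symm_apply y)
    rwa [inv_inv] at h3
  · apply o.injective
    rw [o.apply_symm_apply, hoτ, hτp, ← hoτ (o.symm t), o.apply_symm_apply]

lemma exists_angular_lift {c s ω : ℝ → ℝ} (hω : Continuous ω) (hcs : ∀ t, c t ^ 2 + s t ^ 2 = 1)
    (hc : ∀ t, HasDerivAt c (-(s t * ω t)) t) (hs : ∀ t, HasDerivAt s (c t * ω t) t) :
    ∃ θ : ℝ → ℝ, (∀ t, HasDerivAt θ (ω t) t) ∧ (∀ t, c t = cos (θ t)) ∧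
      (∀ t, s t = sin (θ t)) := by
  obtain ⟨θ₀, hθ₀c, hθ₀s⟩ : ∃ θ₀, c 0 = cos θ₀ ∧ s 0 = sin θ₀ := by
    have hn : ‖(⟨c 0, s 0⟩ : ℂ)‖ = 1 := by
      rw [Complex.norm_def, Complex.normSq_mk, ← sq, ← sq, hcs, Real.sqrt_one]
    have hne : (⟨c 0, s 0⟩ : ℂ) ≠ 0 := by
      intro h; rw [h] at hn; simp at hn
    refine ⟨Complex.arg ⟨c 0, s 0⟩, ?_, ?_⟩
    · rw [Complex.cos_arg hne, hn]; simp
    · rw [Complex.sin_arg, hn]; simp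
  set θ : ℝ → ℝ := fun t => θ₀ + ∫ u in (0 : ℝ)..t, ω u with hθ
  have hθd : ∀ t, HasDerivAt θ (ω t) t := fun t =>
    (intervalIntegral.integral_hasDerivAt_right (hω.intervalIntegrable _ _)
      (hω.stronglyMeasurableAtFilter _ _) hω.continuousAt).const_add θ₀
  set Z : ℝ → ℝ := fun t => (c t - cos (θ t)) ^ 2 + (s t - sin (θ t)) ^ 2 with hZ
  have hZd : ∀ t, HasDerivAt Z 0 t := by
    intro t
    have h1 := ((hc t).sub (hθd t).cos).pow 2
    have h2 := ((hs t).sub (hθd t).sin).pow 2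
    refine (h1.add h2).congr_deriv ?_
    simp only [Pi.sub_apply]
    push_cast
    ring
  have hZ0 : ∀ t, Z t = 0 := by
    intro t
    have h1 : Z t = Z 0 := is_const_of_deriv_eq_zero (fun t => (hZd t).differentiableAt)
      (fun t => (hZd t).deriv) t 0
    rw [h1]
    simp [hZ, hθ, hθ₀c, hθ₀s]
  refine ⟨θ, hθd, fun t => ?_, fun t => ?_⟩
  · have := hZ0 t
    simp only [hZ] at this
    nlinarith [sq_nonneg (c t - cos (θ t)), sq_nonneg (s t - sin (θ t))]
  · have := hZ0 t
    simp only [hZ] at this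
    nlinarith [sq_nonneg (c t - cos (θ t)), sq_nonneg (s t - sin (θ t))]

lemma exists_int_of_periodic_lift {θ ω : ℝ → ℝ} {T : ℝ} (hθ : ∀ t, HasDerivAt θ (ω t) t)
    (hω : ∀ t, ω (t + T) = ω t) (hc : cos (θ T) = cos (θ 0)) (hs : sin (θ T) = sin (θ 0)) :
    ∃ k : ℤ, ∀ t, θ (t + T) = θ t + k * (2 * π) := by
  obtain ⟨k, hk⟩ := Real.Angle.angle_eq_iff_two_pi_dvd_sub.mp (Real.Angle.cos_sin_inj hc hs)
  refine ⟨k, fun t => ?_⟩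
  have hd : ∀ t, HasDerivAt (fun t => θ (t + T) - θ t) 0 t := by
    intro t
    refine (((hθ (t + T)).comp_add_const t T).sub (hθ t)).congr_deriv ?_
    rw [hω, sub_self]
  have h1 := is_const_of_deriv_eq_zero (fun t => (hd t).differentiableAt)
      (fun t => (hd t).deriv) t 0
  simp only [zero_add] at h1
  linarith

end AngularLift

section OvalSolutions

open Set Topology Real

/-- The point of the oval at level `h` with angle `θ`. -/
noncomputable def ovalPoint (A B : ℝ → ℝ) (Q : ℝ × ℝ → ℝ) (h θ : ℝ) : ℝ × ℝ :=
  (A h + B h * cos θ, -(B h * sin θ * Q (A h + B h * cos θ, h)))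

/-- The energy `y ^ 2 / 2 + G x`. -/
noncomputable def energy (G : ℝ[X]) (p : ℝ × ℝ) : ℝ := p.2 ^ 2 / 2 + G.eval p.1

namespace IsOvalChart

variable {G f : ℝ[X]} {A B : ℝ → ℝ} {Q : ℝ × ℝ → ℝ} {J : Set ℝ} {ε : ℝ}

lemma energy_ovalPoint (hc : IsOvalChart G A B Q J) {h : ℝ} (hh : h ∈ J) (θ : ℝ) :
    energy G (ovalPoint A B Q h θ) = h := by
  have h1 := hc.level h hh _ (hc.abs_param_le hh θ)
  have h2 := sin_sq_add_cos_sq θ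
  simp only [energy, ovalPoint]
  have h3 : (B h ^ 2 - (A h + B h * cos θ - A h) ^ 2) = B h ^ 2 * sin θ ^ 2 := by
    have : sin θ ^ 2 = 1 - cos θ ^ 2 := by linarith
    rw [this]; ring
  rw [h3] at h1
  linear_combination (-1 / 2) * h1

lemma hasDerivAt_Q_comp (hc : IsOvalChart G A B Q J) {x h : ℝ → ℝ} {x' h' t : ℝ}
    (hJ : h t ∈ J) (hxle : |x t - A (h t)| ≤ B (h t)) (hx : HasDerivAt x x' t)
    (hh : HasDerivAt h h' t) :
    HasDerivAt (fun t => Q (x t, h t)) (fderiv ℝ Q (x t, h t) (x', h')) t :=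
  ((hc.contDiffAt_Q _ hJ _ hxle).differentiableAt (by norm_num)).hasFDerivAt.comp_hasDerivAt t
    (hx.prodMk hh)

lemma hasDerivAt_ovalPoint (hc : IsOvalChart G A B Q J) {h θ : ℝ → ℝ} {t : ℝ} (hJ : h t ∈ J)
    (hh : HasDerivAt h (-ε * (f.eval (A (h t) + B (h t) * cos (θ t)) * (B (h t) * sin (θ t) *
      Q (A (h t) + B (h t) * cos (θ t), h t)) ^ 2)) t)
    (hθ : HasDerivAt θ (ovalSpeed f A B Q (ε, h t, θ t)) t) :
    HasDerivAt (fun t => ovalPoint A B Q (h t) (θ t))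
      (lienard f (derivative G) ε (ovalPoint A B Q (h t) (θ t))) t := by
  have hA : HasDerivAt A (deriv A (h t)) (h t) :=
    ((hc.contDiffAt_A _ hJ).differentiableAt (by norm_num)).hasDerivAt
  have hB : HasDerivAt B (deriv B (h t)) (h t) :=
    ((hc.contDiffAt_B _ hJ).differentiableAt (by norm_num)).hasDerivAt
  have hle := hc.abs_param_le hJ (θ t)
  have hBpos := hc.B_pos _ hJ
  have hQpos := hc.Q_pos _ hJ _ hle
  have hX : HasDerivAt (fun t => A (h t) + B (h t) * cos (θ t))
      (-(B (h t) * sin (θ t) * Q (A (h t) + B (h t) * cos (θ t), h t))) t := by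
    refine ((hA.comp t hh).add ((hB.comp t hh).mul hθ.cos)).congr_deriv ?_
    simp only [ovalSpeed, Function.comp_apply]
    ring
  have hQd := hc.hasDerivAt_Q_comp (x := fun t => A (h t) + B (h t) * cos (θ t)) hJ hle hX hh
  have hY := (((hB.comp t hh).mul hθ.sin).mul hQd).neg
  have hG : HasDerivAt (fun t => G.eval (A (h t) + B (h t) * cos (θ t)))
      ((derivative G).eval (A (h t) + B (h t) * cos (θ t)) *
        -(B (h t) * sin (θ t) * Q (A (h t) + B (h t) * cos (θ t), h t))) t :=
    (G.hasDerivAt _).comp t hX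
  refine hX.prodMk (hY.congr_deriv ?_)
  have hJev : ∀ᶠ u in 𝓝 t, h u ∈ J := hh.continuousAt.eventually (hc.isOpen.mem_nhds hJ)
  by_cases hs : sin (θ t) = 0
  · have hcos : cos (θ t) = 1 ∨ cos (θ t) = -1 := sin_eq_zero_iff_cos_eq.mp hs
    have hspeed : ovalSpeed f A B Q (ε, h t, θ t) = Q (A (h t) + B (h t) * cos (θ t), h t) := by
      simp [ovalSpeed, hs]
    have hz : (-(B (h t) * sin (θ t) * Q (A (h t) + B (h t) * cos (θ t), h t)),
        -ε * (f.eval (A (h t) + B (h t) * cos (θ t)) * (B (h t) * sin (θ t) *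
          Q (A (h t) + B (h t) * cos (θ t), h t)) ^ 2)) = (0 : ℝ × ℝ) := by
      simp [hs]
    rw [hz, map_zero, hspeed]
    simp only [ovalPoint, Function.comp_apply, hs, Pi.mul_apply]
    rcases hcos with h1 | h1
    · have hr := hc.right _ hJ
      rw [h1] at hQpos ⊢
      simp only [mul_one] at hQpos ⊢
      rw [hr]; ring
    · have hl := hc.left _ hJ
      rw [h1] at hQpos ⊢
      simp only [mul_neg, mul_one, ← sub_eq_add_neg] at hQpos ⊢
      rw [hl]; ring
  · have hE : (fun u => (fun t => -((((B ∘ h) * fun t => sin (θ t)) *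
        fun t => Q (A (h t) + B (h t) * cos (θ t), h t)) t)) u ^ 2 / 2 +
        G.eval (A (h u) + B (h u) * cos (θ u))) =ᶠ[𝓝 t] h := by
      filter_upwards [hJev] with u hu using hc.energy_ovalPoint hu (θ u)
    have hEd := (((hY.pow 2).div_const 2).add hG).unique (hh.congr_of_eventuallyEq hE)
    simp only [ovalPoint, Function.comp_apply, Pi.mul_apply, Pi.neg_apply] at hEd ⊢
    have hne : -(B (h t) * sin (θ t) * Q (A (h t) + B (h t) * cos (θ t), h t)) ≠ 0 := by
      simp [hs, hBpos.ne', hQpos.ne']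
    apply mul_left_cancel₀ hne
    push_cast at hEd
    linear_combination hEd

/-- The Liénard system in oval coordinates. -/
lemma hasDerivAt_coordinates (hc : IsOvalChart G A B Q J) {x y h c s ω : ℝ → ℝ}
    (hx : ∀ t, HasDerivAt x (y t) t)
    (hy : ∀ t, HasDerivAt y (-((derivative G).eval (x t)) - ε * f.eval (x t) * y t) t)
    (hh : ∀ t, h t = y t ^ 2 / 2 + G.eval (x t)) (hJ : ∀ t, h t ∈ J)
    (hle : ∀ t, |x t - A (h t)| ≤ B (h t))
    (hcd : ∀ t, c t = (x t - A (h t)) / B (h t))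
    (hsd : ∀ t, s t = -y t / (B (h t) * Q (x t, h t)))
    (hω : ∀ t, ω t = Q (x t, h t) - ε * (deriv A (h t) + deriv B (h t) * c t) * f.eval (x t) *
      B (h t) * s t * Q (x t, h t) ^ 2) :
    (∀ t, HasDerivAt h (-ε * f.eval (x t) * y t ^ 2) t) ∧ (∀ t, c t ^ 2 + s t ^ 2 = 1) ∧
      Continuous ω ∧ (∀ t, HasDerivAt c (-(s t * ω t)) t) ∧
        ∀ t, HasDerivAt s (c t * ω t) t := by
  have hBpos := fun t => hc.B_pos _ (hJ t)
  have hQpos := fun t => hc.Q_pos _ (hJ t) _ (hle t)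
  have hhd : ∀ t, HasDerivAt h (-ε * f.eval (x t) * y t ^ 2) t := by
    intro t
    rw [show h = fun t => y t ^ 2 / 2 + G.eval (x t) from funext hh]
    refine ((((hy t).pow 2).div_const 2).add ((G.hasDerivAt _).comp t (hx t))).congr_deriv ?_
    push_cast; ring
  have hxc : ∀ t, x t - A (h t) = c t * B (h t) := fun t => by
    rw [hcd]; field_simp [(hBpos t).ne']
  have hys : ∀ t, y t = -(B (h t) * s t * Q (x t, h t)) := fun t => by
    rw [hsd]; field_simp [(hBpos t).ne', (hQpos t).ne']
  have hcs : ∀ t, c t ^ 2 + s t ^ 2 = 1 := by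
    intro t
    have h1 := hc.level _ (hJ t) _ (hle t)
    have h2 : 2 * (h t - G.eval (x t)) = y t ^ 2 := by rw [hh]; ring
    rw [h2, hxc, hys] at h1
    have h3 : (B (h t) * Q (x t, h t)) ^ 2 ≠ 0 :=
      pow_ne_zero _ (mul_ne_zero (hBpos t).ne' (hQpos t).ne')
    apply mul_left_cancel₀ h3
    linear_combination h1
  have hAd : ∀ t, HasDerivAt A (deriv A (h t)) (h t) := fun t =>
    ((hc.contDiffAt_A _ (hJ t)).differentiableAt (by norm_num)).hasDerivAt
  have hBd : ∀ t, HasDerivAt B (deriv B (h t)) (h t) := fun t =>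
    ((hc.contDiffAt_B _ (hJ t)).differentiableAt (by norm_num)).hasDerivAt
  have hQd := fun t => hc.hasDerivAt_Q_comp (hJ t) (hle t) (hx t) (hhd t)
  have hcder : ∀ t, HasDerivAt c (-(s t * ω t)) t := by
    intro t
    rw [show c = fun t => (x t - A (h t)) / B (h t) from funext hcd]
    refine (((hx t).sub ((hAd t).comp t (hhd t))).div ((hBd t).comp t (hhd t))
      (hBpos t).ne').congr_deriv ?_
    have h1 := hxc t
    have h2 := hys t
    have h3 := (hBpos t).ne'
    simp only [Pi.sub_apply, Function.comp_apply]
    rw [h1, hω t, h2]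
    field_simp
    ring
  have hsD : ∀ t, DifferentiableAt ℝ s t := by
    intro t
    rw [show s = fun t => -y t / (B (h t) * Q (x t, h t)) from funext hsd]
    exact ((hy t).neg.div (((hBd t).comp t (hhd t)).mul (hQd t))
      (mul_ne_zero (hBpos t).ne' (hQpos t).ne')).differentiableAt
  have hsder : ∀ t, HasDerivAt s (c t * ω t) t := by
    intro t
    by_cases hst : s t = 0
    · have hyt : y t = 0 := by rw [hys, hst]; simp
      have hωt : ω t = Q (x t, h t) := by rw [hω, hst]; ring
      have h4 := (hy t).neg.div (((hBd t).comp t (hhd t)).mul (hQd t))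
        (mul_ne_zero (hBpos t).ne' (hQpos t).ne')
      rw [show s = fun t => -y t / (B (h t) * Q (x t, h t)) from funext hsd]
      refine h4.congr_deriv ?_
      have hz : (y t, -ε * f.eval (x t) * y t ^ 2) = (0 : ℝ × ℝ) := by simp [hyt]
      rw [hz, map_zero, hωt]
      simp only [Pi.neg_apply, Pi.mul_apply, Function.comp_apply, hyt]
      have h1 := (hBpos t).ne'
      have h2 := (hQpos t).ne'
      have hct : (c t - 1) * (c t + 1) = 0 := by
        have := hcs t
        rw [hst] at this
        linear_combination this
      rcases mul_eq_zero.mp hct with h3 | h3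
      · have h3' : c t = 1 := by linarith
        have hxt : x t = A (h t) + B (h t) := by have := hxc t; rw [h3'] at this; linarith
        have hr := hc.right _ (hJ t)
        rw [← hxt] at hr
        rw [hr, h3']
        field_simp
        ring
      · have h3' : c t = -1 := by linarith
        have hxt : x t = A (h t) - B (h t) := by have := hxc t; rw [h3'] at this; linarith
        have hr := hc.left _ (hJ t)
        rw [← hxt] at hr
        rw [hr, h3']
        field_simp
        ring
    · have h5 := (hsD t).hasDerivAt
      refine h5.congr_deriv ?_
      have h6 := ((hcder t).pow 2).add (h5.pow 2)
      have h7 : (c ^ 2 + s ^ 2) = fun _ => (1 : ℝ) := funext fun t => hcs t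
      rw [h7] at h6
      have h8 := h6.unique (hasDerivAt_const t 1)
      apply mul_left_cancel₀ hst
      push_cast at h8
      linear_combination (1 / 2) * h8
  refine ⟨hhd, hcs, ?_, hcder, hsder⟩
  rw [show ω = _ from funext hω, continuous_iff_continuousAt]
  intro t
  have a1 : ContinuousAt h t := (hhd t).continuousAt
  have a2 : ContinuousAt (fun t => deriv A (h t)) t :=
    ContinuousAt.comp (contDiffAt_deriv (hc.contDiffAt_A _ (hJ t))).continuousAt a1
  have a3 : ContinuousAt (fun t => deriv B (h t)) t :=
    ContinuousAt.comp (contDiffAt_deriv (hc.contDiffAt_B _ (hJ t))).continuousAt a1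
  have a4 : ContinuousAt (fun t => f.eval (x t)) t :=
    ContinuousAt.comp f.continuous.continuousAt (hx t).continuousAt
  have a5 : ContinuousAt (fun t => B (h t)) t := ContinuousAt.comp (hBd t).continuousAt a1
  have a6 := (hQd t).continuousAt
  have a7 := (hcder t).continuousAt
  have a8 := (hsder t).continuousAt
  exact a6.sub (((((continuousAt_const.mul (a2.add (a3.mul a7))).mul a4).mul a5).mul a8).mul
    (a6.pow 2))

end IsOvalChart

end OvalSolutions

section OvalLimitCycle

open Set Topology Real

namespace IsOvalChart

variable {G f : ℝ[X]} {A B : ℝ → ℝ} {Q : ℝ × ℝ → ℝ} {J : Set ℝ} {h₀ α β : ℝ}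

/-- A simple zero of the averaged field yields a limit cycle near the corresponding oval. -/
theorem eventually_exists_limitCycle (hc : IsOvalChart G A B Q J) (hh : h₀ ∈ J)
    (hin : ∀ h ∈ J, ∀ x, |x - A h| ≤ B h → x ∈ Ioo α β)
    (hout : ∀ p : ℝ × ℝ, p.1 ∈ Ioo α β → energy G p ∈ J →
      |p.1 - A (energy G p)| ≤ B (energy G p))
    (h0 : ∫ θ in (0 : ℝ)..2 * π, ovalField f A B Q (0, h₀, θ) = 0)
    (h1 : ∫ θ in (0 : ℝ)..2 * π, fieldSlope (ovalField f A B Q) h₀ θ ≠ 0) :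
    ∀ᶠ ε in 𝓝[>] (0 : ℝ), ∃ Γ, IsLimitCycle (lienard f (derivative G) ε) Γ ∧
      ∀ p ∈ Γ, p.1 ∈ Ioo α β ∧ energy G p ∈ J := by
  obtain ⟨δ, hδ, hspeed⟩ := Metric.eventually_nhds_iff.mp
    (hc.eventually_ovalSpeed_pos (f := f) hh)
  obtain ⟨δ', hδ', hJ'⟩ := Metric.isOpen_iff.mp hc.isOpen h₀ hh
  obtain ⟨ρ, hρev, hρδ⟩ := (((hc.isPeriodicField (f := f) hh).eventually_exists_isolated h0
    h1).and (Ioo_mem_nhdsGT (lt_min hδ hδ'))).exists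
  filter_upwards [hρev, Ioo_mem_nhdsGT hδ] with ε hε hεδ
  obtain ⟨hs, hsper, hsρ, hsd, huniq⟩ := hε
  have hJ : ∀ h, |h - h₀| < ρ → h ∈ J := fun h hlt =>
    hJ' (lt_of_lt_of_le (b := ρ) hlt (hρδ.2.le.trans (min_le_right _ _)))
  have hpos : ∀ h θ, |h - h₀| < ρ → 0 < ovalSpeed f A B Q (ε, h, θ) := by
    intro h θ hlt
    refine hspeed (y := (ε, h)) ?_ θ
    simp only [Prod.dist_eq, Real.dist_eq, sub_zero, max_lt_iff, abs_of_pos hεδ.1]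
    exact ⟨hεδ.2, hlt.trans (hρδ.2.trans_le (min_le_left _ _))⟩
  have hfield : ∀ h θ, |h - h₀| < ρ → ovalSpeed f A B Q (ε, h, θ) * ovalField f A B Q (ε, h, θ) =
      -(f.eval (A h + B h * cos θ) * (B h * sin θ * Q (A h + B h * cos θ, h)) ^ 2) := by
    intro h θ hlt
    have := (hpos h θ hlt).ne'
    simp only [ovalField]
    field_simp
  have hspeedc : ∀ h θ, |h - h₀| < ρ → ContinuousAt (ovalSpeed f A B Q) (ε, h, θ) :=
    fun h θ hlt => (hc.contDiffAt_ovalSpeed (hJ h hlt) ε θ).continuousAt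
  have hsc : Continuous hs := continuous_iff_continuousAt.mpr fun θ => (hsd θ).continuousAt
  obtain ⟨Θ, T, hT, hΘ, hΘT⟩ := exists_time_change
    (w := fun θ => ovalSpeed f A B Q (ε, hs θ, θ))
    (continuous_iff_continuousAt.mpr fun θ =>
      ContinuousAt.comp (f := fun θ => (ε, hs θ, θ)) (g := ovalSpeed f A B Q)
        (hspeedc _ θ (hsρ θ)) (by fun_prop))
    (fun θ => hpos _ θ (hsρ θ))
    (fun θ => by simp only [hsper, ovalSpeed, cos_add_two_pi, sin_add_two_pi])
  have hΘsurj : Function.Surjective Θ :=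
    (continuous_iff_continuousAt.mpr fun t => (hΘ t).continuousAt).surjective_of_add_period
      Real.two_pi_pos hΘT
  set Ψ : ℝ → ℝ × ℝ := fun θ => ovalPoint A B Q (hs θ) θ with hΨ
  have hΨin : ∀ θ, (Ψ θ).1 ∈ Ioo α β := fun θ =>
    hin _ (hJ _ (hsρ θ)) _ (hc.abs_param_le (hJ _ (hsρ θ)) θ)
  have hΨe : ∀ θ, energy G (Ψ θ) = hs θ := fun θ => hc.energy_ovalPoint (hJ _ (hsρ θ)) θ
  have hrange : range (Ψ ∘ Θ) = range Ψ := hΘsurj.range_comp Ψ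
  have henergy : Continuous (energy G) := by unfold energy; fun_prop
  refine ⟨range Ψ, ⟨⟨Ψ ∘ Θ, ?_, ⟨T, hT, ?_⟩, ?_, hrange.symm⟩,
    {p | p.1 ∈ Ioo α β ∧ |energy G p - h₀| < ρ}, ?_, ?_, ?_⟩, ?_⟩
  · intro t
    refine hc.hasDerivAt_ovalPoint (h := fun t => hs (Θ t)) (hJ _ (hsρ _)) ?_ (hΘ t)
    refine ((hsd (Θ t)).comp t (hΘ t)).congr_deriv ?_
    rw [mul_assoc, mul_comm (ovalField _ _ _ _ _), hfield _ _ (hsρ _)]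
    ring
  · intro t
    simp only [Function.comp_apply, hΨ, ovalPoint, hΘT, hsper, cos_add_two_pi, sin_add_two_pi]
  · obtain ⟨t₁, ht₁⟩ := hΘsurj (π / 2)
    obtain ⟨t₂, ht₂⟩ := hΘsurj 0
    refine ⟨t₁, t₂, fun heq => ?_⟩
    have h2 := congrArg Prod.snd heq
    simp only [Function.comp_apply, hΨ, ovalPoint, ht₁, ht₂, sin_zero, sin_pi_div_two, mul_zero,
      mul_one, zero_mul, neg_zero, neg_eq_zero] at h2
    have a1 := hc.B_pos _ (hJ _ (hsρ (π / 2)))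
    have a2 := hc.Q_pos _ (hJ _ (hsρ (π / 2))) _ (hc.abs_param_le (hJ _ (hsρ (π / 2))) (π / 2))
    exact (mul_pos a1 a2).ne' h2
  · exact (isOpen_Ioo.preimage continuous_fst).inter
      (isOpen_lt (henergy.sub continuous_const).abs continuous_const)
  · rintro _ ⟨θ, rfl⟩
    exact ⟨hΨin θ, by rw [hΨe]; exact hsρ θ⟩
  · rintro Γ' ⟨γ, hγ, ⟨S, hS, hγS⟩, -, rfl⟩ hΓU
    have hU : ∀ t, (γ t).1 ∈ Ioo α β ∧ |energy G (γ t) - h₀| < ρ := fun t => hΓU ⟨t, rfl⟩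
    set x : ℝ → ℝ := fun t => (γ t).1 with hxdef
    set y : ℝ → ℝ := fun t => (γ t).2 with hydef
    set h : ℝ → ℝ := fun t => energy G (γ t) with hhdef
    set c : ℝ → ℝ := fun t => (x t - A (h t)) / B (h t) with hcdef
    set s : ℝ → ℝ := fun t => -y t / (B (h t) * Q (x t, h t)) with hsdef
    set ω : ℝ → ℝ := fun t => Q (x t, h t) - ε * (deriv A (h t) + deriv B (h t) * c t) *
      f.eval (x t) * B (h t) * s t * Q (x t, h t) ^ 2 with hωdef
    have hhJ : ∀ t, h t ∈ J := fun t => hJ _ (hU t).2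
    have hle : ∀ t, |x t - A (h t)| ≤ B (h t) := fun t => hout _ (hU t).1 (hhJ t)
    have hx : ∀ t, HasDerivAt x (y t) t := fun t => (hγ t).fst
    have hy : ∀ t, HasDerivAt y (-((derivative G).eval (x t)) - ε * f.eval (x t) * y t) t :=
      fun t => (hγ t).snd
    obtain ⟨hhd, hcs, hωc, hcd, hsd'⟩ := hc.hasDerivAt_coordinates hx hy (h := h) (c := c)
      (s := s) (ω := ω) (fun t => rfl) hhJ hle (fun t => rfl) (fun t => rfl) (fun t => rfl)
    obtain ⟨θ, hθ, hcθ, hsθ⟩ := exists_angular_lift hωc hcs hcd hsd'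
    have hBpos := fun t => hc.B_pos _ (hhJ t)
    have hQpos := fun t => hc.Q_pos _ (hhJ t) _ (hle t)
    have hxθ : ∀ t, x t = A (h t) + B (h t) * cos (θ t) := fun t => by
      rw [← hcθ]; simp only [hcdef]; field_simp [(hBpos t).ne']; ring
    have hyθ : ∀ t, y t = -(B (h t) * sin (θ t) * Q (x t, h t)) := fun t => by
      rw [← hsθ]; simp only [hsdef]; field_simp [(hBpos t).ne', (hQpos t).ne']
    have hωs : ∀ t, ω t = ovalSpeed f A B Q (ε, h t, θ t) := fun t => by
      simp only [ovalSpeed, ← hxθ]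
      rw [← hcθ, ← hsθ]
    have hγΨ : ∀ t, γ t = ovalPoint A B Q (h t) (θ t) := fun t =>
      Prod.ext (hxθ t) (by simp only [ovalPoint, ← hxθ]; exact hyθ t)
    have hhS : ∀ t, h (t + S) = h t := fun t => by simp only [hhdef, hγS t]
    have hωS : ∀ t, ω (t + S) = ω t := fun t => by
      simp only [hωdef, hcdef, hsdef, hhS]
      simp only [hxdef, hydef, hγS t]
    have hcS : c S = c 0 := by
      have := hγS 0
      rw [zero_add] at this
      simp only [hcdef, hxdef, hhdef, this]
    have hsS : s S = s 0 := by
      have := hγS 0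
      rw [zero_add] at this
      simp only [hsdef, hxdef, hydef, hhdef, this]
    obtain ⟨k, hk⟩ := exists_int_of_periodic_lift hθ hωS (by rw [← hcθ, ← hcθ, hcS])
      (by rw [← hsθ, ← hsθ, hsS])
    have hωpos : ∀ t, 0 < ω t := fun t => by rw [hωs]; exact hpos _ _ (hU t).2
    have hhs : ∀ t, h t = hs (θ t) := by
      refine huniq θ h ω S k hS hθ hωpos (fun t => ?_) (fun t => (hU t).2) hhS hk
      refine (hhd t).congr_deriv ?_
      rw [mul_assoc, hωs, mul_assoc, hfield (h t) (θ t) (hU t).2, ← hxθ, hyθ]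
      ring
    have hθsurj : Function.Surjective θ := by
      have hmono : StrictMono θ := strictMono_of_deriv_pos fun t => by
        rw [(hθ t).deriv]; exact hωpos t
      have hlt : θ 0 < θ (0 + S) := hmono (by linarith)
      rw [hk] at hlt
      exact (continuous_iff_continuousAt.mpr fun t =>
        (hθ t).continuousAt).surjective_of_add_period (by linarith) hk
    have : γ = Ψ ∘ θ := funext fun t => by
      simp only [Function.comp_apply, hΨ, ← hhs, ← hγΨ]
    rw [this, hθsurj.range_comp]
  · rintro _ ⟨θ, rfl⟩
    exact ⟨hΨin θ, by rw [hΨe]; exact hJ _ (hsρ θ)⟩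

end IsOvalChart

end OvalLimitCycle

section Cells

open Set Topology Real

lemma exists_second_divided_difference (G : ℝ[X]) :
    ∃ (D : ℝ × ℝ → ℝ) (E : ℝ × ℝ × ℝ → ℝ), ContDiff ℝ 2 D ∧ ContDiff ℝ 2 E ∧
      ∀ x a b, G.eval x = G.eval a + (x - a) * D (a, b) + (x - a) * (x - b) * E (x, a, b) := by
  have hX : ∀ P : ℝ[X], (∃ (D : ℝ × ℝ → ℝ) (E : ℝ × ℝ × ℝ → ℝ), ContDiff ℝ 2 D ∧ ContDiff ℝ 2 E ∧
      ∀ x a b, P.eval x = P.eval a + (x - a) * D (a, b) + (x - a) * (x - b) * E (x, a, b)) →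
      ∃ (D : ℝ × ℝ → ℝ) (E : ℝ × ℝ × ℝ → ℝ), ContDiff ℝ 2 D ∧ ContDiff ℝ 2 E ∧
      ∀ x a b, (P * X).eval x =
        (P * X).eval a + (x - a) * D (a, b) + (x - a) * (x - b) * E (x, a, b) := by
    rintro P ⟨D, E, hD, hE, h⟩
    have hP : ContDiff ℝ 2 fun p : ℝ × ℝ => P.eval p.1 := by
      have h1 : ContDiff ℝ 2 fun x : ℝ => P.eval x :=
        contDiff_iff_contDiffAt.mpr fun x => IsOvalChart.contDiffAt_eval P x
      exact h1.comp contDiff_fst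
    refine ⟨fun p => P.eval p.1 + p.2 * D p, fun p => p.1 * E p + D p.2, by fun_prop, by fun_prop,
      fun x a b => ?_⟩
    simp only [eval_mul, eval_X]
    linear_combination x * h x a b
  induction G using Polynomial.induction_on with
  | C c => exact ⟨fun _ => 0, fun _ => 0, contDiff_const, contDiff_const, by simp⟩
  | add p q hp hq =>
    obtain ⟨D, E, hD, hE, h⟩ := hp
    obtain ⟨D', E', hD', hE', h'⟩ := hq
    refine ⟨D + D', E + E', hD.add hD', hE.add hE', fun x a b => ?_⟩
    simp only [eval_add, Pi.add_apply]
    linear_combination h x a b + h' x a b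
  | monomial n c ih =>
    rw [pow_succ, ← mul_assoc]
    exact hX _ ih

lemma exists_smooth_branch {G : ℝ[X]} {u v : ℝ} {J : Set ℝ} (hJ : IsOpen J)
    (hne : ∀ x ∈ Ioo u v, (derivative G).eval x ≠ 0)
    (hinj : InjOn (fun x => G.eval x) (Ioo u v)) (hex : ∀ h ∈ J, ∃ x ∈ Ioo u v, G.eval x = h) :
    ∃ a : ℝ → ℝ, ∀ h ∈ J, a h ∈ Ioo u v ∧ G.eval (a h) = h ∧ ContDiffAt ℝ 2 a h := by
  choose! a ha haG using hex
  refine ⟨a, fun h hh => ⟨ha h hh, haG h hh, ?_⟩⟩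
  have h1 : ContDiffAt ℝ 2 (fun x => G.eval x) (a h) := IsOvalChart.contDiffAt_eval G _
  have h2 := (G.hasDerivAt (a h)).hasFDerivAt_equiv (hne _ (ha h hh))
  have hs := h1.hasStrictFDerivAt' h2 (by norm_num)
  have h3 := h1.to_localInverse h2 (by norm_num)
  have h4 := hs.localInverse_tendsto
  have h5 := hs.eventually_right_inverse
  have e : G.eval (a h) = h := haG h hh
  beta_reduce at h3 h4 h5
  rw [e] at h3 h4 h5
  refine h3.congr_of_eventuallyEq ?_
  filter_upwards [hJ.mem_nhds hh, h4.eventually (isOpen_Ioo.mem_nhds (ha h hh)), h5] with y hy hy1 hy2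
  exact hinj (ha y hy) hy1 ((haG y hy).trans hy2.symm)

/-- For every level `h ∈ (h₁, h₂)`, the set `{x ∈ [α, β] | G x ≤ h}` is a segment on which `G` has
a single well, `h₁` bounding the bottom of the well. -/
structure IsCell (G : ℝ[X]) (α β h₁ h₂ : ℝ) : Prop where
  lt : h₁ < h₂
  lt_left : h₂ < G.eval α
  lt_right : h₂ < G.eval β
  exists_core : ∃ a₁ b₁, α < a₁ ∧ a₁ ≤ b₁ ∧ b₁ < β ∧
    (∀ x ∈ Icc α a₁, (derivative G).eval x < 0) ∧ (∀ x ∈ Icc b₁ β, 0 < (derivative G).eval x) ∧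
      ∀ x ∈ Icc a₁ b₁, G.eval x < h₁

/-- The first order Melnikov function of a cell. -/
noncomputable def melnikov (f G : ℝ[X]) (α β h : ℝ) : ℝ :=
  ∫ x in α..β, f.eval x * √(2 * (h - G.eval x))

namespace IsCell

variable {G : ℝ[X]} {α β h₁ h₂ : ℝ}

lemma exists_branches (hc : IsCell G α β h₁ h₂) : ∃ a b : ℝ → ℝ, ∀ h ∈ Ioo h₁ h₂,
    α < a h ∧ a h < b h ∧ b h < β ∧ G.eval (a h) = h ∧ G.eval (b h) = h ∧
    (derivative G).eval (a h) < 0 ∧ 0 < (derivative G).eval (b h) ∧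
    (∀ x ∈ Ico α (a h), h < G.eval x) ∧ (∀ x ∈ Ioo (a h) (b h), G.eval x < h) ∧
    (∀ x ∈ Ioc (b h) β, h < G.eval x) ∧ ContDiffAt ℝ 2 a h ∧ ContDiffAt ℝ 2 b h := by
  obtain ⟨a₁, b₁, hαa, hab, hbβ, hga, hgb, hcore⟩ := hc.exists_core
  have hanti : StrictAntiOn (fun x => G.eval x) (Icc α a₁) := by
    refine strictAntiOn_of_deriv_neg (convex_Icc _ _) G.continuous.continuousOn fun x hx => ?_
    rw [Polynomial.deriv]
    exact hga x (interior_subset hx)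
  have hmono : StrictMonoOn (fun x => G.eval x) (Icc b₁ β) := by
    refine strictMonoOn_of_deriv_pos (convex_Icc _ _) G.continuous.continuousOn fun x hx => ?_
    rw [Polynomial.deriv]
    exact hgb x (interior_subset hx)
  have hexa : ∀ h ∈ Ioo h₁ h₂, ∃ x ∈ Ioo α a₁, G.eval x = h := fun h hh =>
    intermediate_value_Ioo' hαa.le G.continuous.continuousOn
      ⟨(hcore a₁ ⟨le_rfl, hab⟩).trans hh.1, hh.2.trans hc.lt_left⟩
  have hexb : ∀ h ∈ Ioo h₁ h₂, ∃ x ∈ Ioo b₁ β, G.eval x = h := fun h hh =>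
    intermediate_value_Ioo hbβ.le G.continuous.continuousOn
      ⟨(hcore b₁ ⟨hab, le_rfl⟩).trans hh.1, hh.2.trans hc.lt_right⟩
  obtain ⟨a, ha⟩ := exists_smooth_branch isOpen_Ioo
    (fun x hx => (hga x (Ioo_subset_Icc_self hx)).ne) (hanti.injOn.mono Ioo_subset_Icc_self) hexa
  obtain ⟨b, hb⟩ := exists_smooth_branch isOpen_Ioo
    (fun x hx => (hgb x (Ioo_subset_Icc_self hx)).ne') (hmono.injOn.mono Ioo_subset_Icc_self) hexb
  refine ⟨a, b, fun h hh => ?_⟩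
  obtain ⟨⟨a1, a2⟩, a3, a4⟩ := ha h hh
  obtain ⟨⟨b1, b2⟩, b3, b4⟩ := hb h hh
  refine ⟨a1, by linarith, b2, a3, b3, hga _ ⟨a1.le, a2.le⟩, hgb _ ⟨b1.le, b2.le⟩,
    fun x hx => ?_, fun x hx => ?_, fun x hx => ?_, a4, b4⟩
  · have := hanti ⟨hx.1, hx.2.le.trans a2.le⟩ ⟨a1.le, a2.le⟩ hx.2
    simp only [a3] at this
    exact this
  · rcases le_total x a₁ with h1 | h1
    · have := hanti ⟨a1.le, a2.le⟩ ⟨a1.le.trans hx.1.le, h1⟩ hx.1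
      simp only [a3] at this
      exact this
    · rcases le_total x b₁ with h2 | h2
      · exact (hcore x ⟨h1, h2⟩).trans hh.1
      · have := hmono ⟨h2, hx.2.le.trans b2.le⟩ ⟨b1.le, b2.le⟩ hx.2
        simp only [b3] at this
        exact this
  · have := hmono ⟨b1.le, b2.le⟩ ⟨b1.le.trans hx.1.le, hx.2⟩ hx.1
    simp only [b3] at this
    exact this

/-- Cells carry oval coordinates. -/
lemma exists_chart (hc : IsCell G α β h₁ h₂) : ∃ (A B : ℝ → ℝ) (Q : ℝ × ℝ → ℝ),
    IsOvalChart G A B Q (Ioo h₁ h₂) ∧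
    (∀ h ∈ Ioo h₁ h₂, ∀ x, |x - A h| ≤ B h → x ∈ Ioo α β) ∧
    (∀ h ∈ Ioo h₁ h₂, ∀ x ∈ Icc α β, G.eval x ≤ h → |x - A h| ≤ B h) := by
  obtain ⟨a, b, hab⟩ := hc.exists_branches
  obtain ⟨D, E, hD, hE, hDE⟩ := exists_second_divided_difference G
  have hle : ∀ h x, |x - (a h + b h) / 2| ≤ (b h - a h) / 2 ↔ a h ≤ x ∧ x ≤ b h := by
    intro h x
    rw [abs_le]
    constructor <;> rintro ⟨h1, h2⟩ <;> constructor <;> linarith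
  have hD0 : ∀ h ∈ Ioo h₁ h₂, D (a h, b h) = 0 := by
    intro h hh
    obtain ⟨-, hlt, -, hGa, hGb, -⟩ := hab h hh
    have h1 := hDE (b h) (a h) (b h)
    rw [hGa, hGb] at h1
    have h2 : (b h - a h) * D (a h, b h) = 0 := by linear_combination -h1
    exact (mul_eq_zero.mp h2).resolve_left (sub_pos.mpr hlt).ne'
  have hlev : ∀ h ∈ Ioo h₁ h₂, ∀ x, G.eval x = h + (x - a h) * (x - b h) * E (x, a h, b h) := by
    intro h hh x
    have := hDE x (a h) (b h)
    rw [hD0 h hh, (hab h hh).2.2.2.1] at this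
    linarith
  have hder : ∀ h ∈ Ioo h₁ h₂, ∀ x, (x - a h) * (x - b h) = 0 →
      (derivative G).eval x = (2 * x - a h - b h) * E (x, a h, b h) := by
    intro h hh x hx
    have h1 := G.hasDerivAt x
    have hEd : DifferentiableAt ℝ (fun x => E (x, a h, b h)) x := by
      have := hE.differentiable (by norm_num)
      fun_prop
    have h2 := ((((hasDerivAt_id x).sub_const (a h)).mul ((hasDerivAt_id x).sub_const (b h))).mul
      hEd.hasDerivAt).const_add h
    have h3 : (fun x => G.eval x) = fun x => h + (x - a h) * (x - b h) * E (x, a h, b h) :=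
      funext (hlev h hh)
    rw [h3] at h1
    have h4 := h1.unique h2
    simp only [Pi.mul_apply, id, hx] at h4
    linear_combination h4
  have hEpos : ∀ h ∈ Ioo h₁ h₂, ∀ x, a h ≤ x → x ≤ b h → 0 < E (x, a h, b h) := by
    intro h hh x hx1 hx2
    obtain ⟨-, hlt, -, hGa, hGb, hga, hgb, -, hin, -⟩ := hab h hh
    rcases hx1.eq_or_lt with rfl | h1
    · have := hder h hh (a h) (by ring)
      by_contra hcon
      nlinarith
    · rcases hx2.eq_or_lt with rfl | h2
      · have := hder h hh (b h) (by ring)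
        by_contra hcon
        nlinarith
      · have h3 := hin x ⟨h1, h2⟩
        rw [hlev h hh x] at h3
        have h4 : 0 < (x - a h) * (b h - x) := mul_pos (by linarith) (by linarith)
        by_contra hcon
        nlinarith
  refine ⟨fun h => (a h + b h) / 2, fun h => (b h - a h) / 2,
    fun p => √(2 * E (p.1, a p.2, b p.2)), ?_, ?_, ?_⟩
  · refine ⟨isOpen_Ioo, fun h hh => ?_, fun h hh => ?_, fun h hh => ?_, fun h hh x hx => ?_,
      fun h hh x hx => ?_, fun h hh x hx => ?_, fun h hh => ?_, fun h hh => ?_⟩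
    · have := (hab h hh).2.1
      linarith
    · obtain ⟨h1, h2⟩ := (hab h hh).2.2.2.2.2.2.2.2.2.2
      exact (h1.add h2).div_const 2
    · obtain ⟨h1, h2⟩ := (hab h hh).2.2.2.2.2.2.2.2.2.2
      exact (h2.sub h1).div_const 2
    · obtain ⟨hx1, hx2⟩ := (hle h x).mp hx
      have := hEpos h hh x hx1 hx2
      positivity
    · obtain ⟨hx1, hx2⟩ := (hle h x).mp hx
      have hp := hEpos h hh x hx1 hx2
      obtain ⟨h1, h2⟩ := (hab h hh).2.2.2.2.2.2.2.2.2.2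
      have h3 : ContDiffAt ℝ 2 (fun p : ℝ × ℝ => a p.2) (x, h) :=
        ContDiffAt.comp (x, h) (g := a) h1 contDiffAt_snd
      have h4 : ContDiffAt ℝ 2 (fun p : ℝ × ℝ => b p.2) (x, h) :=
        ContDiffAt.comp (x, h) (g := b) h2 contDiffAt_snd
      have h5 : ContDiffAt ℝ 2 (fun p : ℝ × ℝ => E (p.1, a p.2, b p.2)) (x, h) :=
        ContDiffAt.comp (x, h) (g := E) hE.contDiffAt (contDiffAt_fst.prodMk (h3.prodMk h4))
      exact ((contDiffAt_const.mul h5).sqrt (by positivity)).of_le (by norm_num)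
    · obtain ⟨hx1, hx2⟩ := (hle h x).mp hx
      have hp := hEpos h hh x hx1 hx2
      simp only
      rw [sq_sqrt (by positivity), hlev h hh x]
      ring
    · have hlt := (hab h hh).2.1
      have hp := hEpos h hh (b h) hlt.le le_rfl
      have e1 : (a h + b h) / 2 + (b h - a h) / 2 = b h := by ring
      simp only [e1]
      rw [sq_sqrt (by positivity), hder h hh (b h) (by ring)]
      ring
    · have hlt := (hab h hh).2.1
      have hp := hEpos h hh (a h) le_rfl hlt.le
      have e1 : (a h + b h) / 2 - (b h - a h) / 2 = a h := by ring
      simp only [e1]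
      rw [sq_sqrt (by positivity), hder h hh (a h) (by ring)]
      ring
  · intro h hh x hx
    obtain ⟨hx1, hx2⟩ := (hle h x).mp hx
    have := hab h hh
    exact ⟨this.1.trans_le hx1, hx2.trans_lt this.2.2.1⟩
  · intro h hh x hx hGx
    obtain ⟨-, -, -, -, -, -, -, h1, -, h2, -⟩ := hab h hh
    refine (hle h x).mpr ⟨?_, ?_⟩
    · by_contra hcon
      exact absurd hGx (not_le.mpr (h1 x ⟨hx.1, not_le.mp hcon⟩))
    · by_contra hcon
      exact absurd hGx (not_le.mpr (h2 x ⟨not_le.mp hcon, hx.2⟩))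

lemma melnikov_eq {A B : ℝ → ℝ} {Q : ℝ × ℝ → ℝ}
    (hch : IsOvalChart G A B Q (Ioo h₁ h₂))
    (hin : ∀ h ∈ Ioo h₁ h₂, ∀ x, |x - A h| ≤ B h → x ∈ Ioo α β)
    (hout : ∀ h ∈ Ioo h₁ h₂, ∀ x ∈ Icc α β, G.eval x ≤ h → |x - A h| ≤ B h)
    (f : ℝ[X]) {h : ℝ} (hh : h ∈ Ioo h₁ h₂) :
    ∫ θ in (0 : ℝ)..2 * π, ovalField f A B Q (0, h, θ) = -2 * melnikov f G α β h := by
  rw [hch.integral_ovalField hh, melnikov]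
  congr 1
  have hB := hch.B_pos h hh
  have hl := hin h hh (A h - B h) (by rw [sub_sub_cancel_left, abs_neg, abs_of_pos hB])
  have hr := hin h hh (A h + B h) (by rw [add_sub_cancel_left, abs_of_pos hB])
  have hcont : Continuous fun x => f.eval x * √(2 * (h - G.eval x)) := by fun_prop
  have hz : ∀ x ∈ Icc α β, B h < |x - A h| → f.eval x * √(2 * (h - G.eval x)) = 0 := by
    intro x hx hlt
    have h1 : h < G.eval x := by
      by_contra hcon
      exact absurd (hout h hh x hx (not_lt.mp hcon)) (not_le.mpr hlt)
    rw [Real.sqrt_eq_zero_of_nonpos (by linarith), mul_zero]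
  have i1 : ∫ x in α..(A h - B h), f.eval x * √(2 * (h - G.eval x)) = 0 := by
    rw [intervalIntegral.integral_of_le hl.1.le, MeasureTheory.integral_Ioc_eq_integral_Ioo]
    refine MeasureTheory.setIntegral_eq_zero_of_forall_eq_zero fun x hx => ?_
    refine hz x ⟨hx.1.le, hx.2.le.trans hl.2.le⟩ ?_
    rw [lt_abs]; right; linarith [hx.2]
  have i2 : ∫ x in (A h + B h)..β, f.eval x * √(2 * (h - G.eval x)) = 0 := by
    rw [intervalIntegral.integral_of_le hr.2.le]
    refine MeasureTheory.setIntegral_eq_zero_of_forall_eq_zero fun x hx => ?_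
    refine hz x ⟨hr.1.le.trans hx.1.le, hx.2⟩ ?_
    rw [lt_abs]; left; linarith [hx.1]
  have i3 := intervalIntegral.integral_add_adjacent_intervals
    (hcont.intervalIntegrable (μ := MeasureTheory.volume) α (A h - B h))
    (hcont.intervalIntegrable (A h - B h) (A h + B h))
  have i4 := intervalIntegral.integral_add_adjacent_intervals
    (hcont.intervalIntegrable (μ := MeasureTheory.volume) α (A h + B h))
    (hcont.intervalIntegrable (A h + B h) β)
  linarith

lemma differentiableAt_melnikov (hc : IsCell G α β h₁ h₂) (f : ℝ[X]) {h : ℝ}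
    (hh : h ∈ Ioo h₁ h₂) : DifferentiableAt ℝ (melnikov f G α β) h := by
  obtain ⟨A, B, Q, hch, hin, hout⟩ := hc.exists_chart
  have h1 := ((hch.isPeriodicField (f := f) hh).hasDerivAt_integral).const_mul (-1 / 2)
  refine (h1.congr_of_eventuallyEq ?_).differentiableAt
  filter_upwards [isOpen_Ioo.mem_nhds hh] with u hu
  rw [melnikov_eq hch hin hout f hu]
  ring

/-- Poincaré–Pontryagin: a simple zero of the Melnikov function of a cell produces a limit cycle in
the region of the plane corresponding to this cell. -/
theorem eventually_exists_limitCycle (hc : IsCell G α β h₁ h₂) {f : ℝ[X]} {h : ℝ}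
    (hh : h ∈ Ioo h₁ h₂) (h0 : melnikov f G α β h = 0)
    (h1 : deriv (melnikov f G α β) h ≠ 0) :
    ∀ᶠ ε in 𝓝[>] (0 : ℝ), ∃ Γ, IsLimitCycle (lienard f (derivative G) ε) Γ ∧
      ∀ p ∈ Γ, p.1 ∈ Ioo α β ∧ energy G p ∈ Ioo h₁ h₂ := by
  obtain ⟨A, B, Q, hch, hin, hout⟩ := hc.exists_chart
  refine hch.eventually_exists_limitCycle (f := f) hh hin (fun p hp hJ => ?_) ?_ ?_
  · refine hout _ hJ _ (Ioo_subset_Icc_self hp) ?_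
    simp only [energy]
    nlinarith [sq_nonneg p.2]
  · rw [melnikov_eq hch hin hout f hh, h0, mul_zero]
  · intro hcon
    apply h1
    have h2 := ((hch.isPeriodicField (f := f) hh).hasDerivAt_integral).const_mul (-1 / 2)
    rw [hcon, mul_zero] at h2
    refine (h2.congr_of_eventuallyEq ?_).deriv
    filter_upwards [isOpen_Ioo.mem_nhds hh] with u hu
    rw [melnikov_eq hch hin hout f hu]
    ring

end IsCell

end Cells

section Families

open Set Topology Real

lemma melnikov_add (f₁ f₂ G : ℝ[X]) (α β h : ℝ) :
    melnikov (f₁ + f₂) G α β h = melnikov f₁ G α β h + melnikov f₂ G α β h := by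
  unfold melnikov
  rw [← intervalIntegral.integral_add]
  · simp [add_mul]
  all_goals exact Continuous.intervalIntegrable (by fun_prop) _ _

lemma melnikov_C_mul (c : ℝ) (f G : ℝ[X]) (α β h : ℝ) :
    melnikov (C c * f) G α β h = c * melnikov f G α β h := by
  simp [melnikov, mul_assoc]

lemma continuous_melnikov (f G : ℝ[X]) (α β : ℝ) : Continuous (melnikov f G α β) := by
  unfold melnikov
  exact intervalIntegral.continuous_parametric_intervalIntegral_of_continuous' (by fun_prop) _ _

lemma IsCell.melnikov_one_pos {G : ℝ[X]} {α β h₁ h₂ h : ℝ} (hc : IsCell G α β h₁ h₂)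
    (hh : h₁ ≤ h) : 0 < melnikov 1 G α β h := by
  obtain ⟨a₁, b₁, hαa, hab, hbβ, -, -, hcore⟩ := hc.exists_core
  refine intervalIntegral.integral_pos (by linarith) (by fun_prop) (fun x _ => ?_)
    ⟨a₁, ⟨hαa.le, by linarith⟩, ?_⟩
  · simp
  · have := hcore a₁ ⟨le_rfl, hab⟩
    simp only [eval_one, one_mul]
    exact Real.sqrt_pos.mpr (by linarith)

lemma ae_forall_deriv_ne_of_eq {φ : ℝ → ℝ} {s : Set ℝ}
    (hφ : ∀ x ∈ s, DifferentiableAt ℝ φ x) :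
    ∀ᵐ c : ℝ, ∀ x ∈ s, φ x = c → deriv φ x ≠ 0 := by
  have h0 := MeasureTheory.addHaar_image_eq_zero_of_det_fderivWithin_eq_zero
    (MeasureTheory.volume : MeasureTheory.Measure ℝ) (f := φ) (s := {x ∈ s | deriv φ x = 0})
    (f' := fun _ => 0) (fun x hx => ?_) (by simp)
  · filter_upwards [MeasureTheory.compl_mem_ae_iff.mpr h0] with c hc x hx hxc hd
    exact hc ⟨x, ⟨hx, hd⟩, hxc⟩
  · have := ((hφ x hx.1).hasDerivAt.hasFDerivAt).hasFDerivWithinAt (s := {x ∈ s | deriv φ x = 0})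
    rw [hx.2] at this
    rwa [ContinuousLinearMap.toSpanSingleton_zero] at this

/-- A family of cells of `G` with pairwise disjoint regions, across each of which the Melnikov
function of `f` changes sign. -/
structure IsCellFamily {ι : Type*} (f G : ℝ[X]) (α β h₁ h₂ : ι → ℝ) : Prop where
  isCell : ∀ i, IsCell G (α i) (β i) (h₁ i) (h₂ i)
  disjoint : ∀ i j, i ≠ j → Disjoint (Ioo (α i) (β i)) (Ioo (α j) (β j)) ∨
    Disjoint (Ioo (h₁ i) (h₂ i)) (Ioo (h₁ j) (h₂ j))
  sign : ∀ i, melnikov f G (α i) (β i) (h₁ i) * melnikov f G (α i) (β i) (h₂ i) < 0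

namespace IsCellFamily

variable {ι : Type*} {f G : ℝ[X]} {α β h₁ h₂ : ι → ℝ}

lemma exists_simple_zeros [Finite ι] (hc : IsCellFamily f G α β h₁ h₂) :
    ∃ c : ℝ, ∀ i, ∃ h ∈ Ioo (h₁ i) (h₂ i), melnikov (f + C c) G (α i) (β i) h = 0 ∧
      deriv (melnikov (f + C c) G (α i) (β i)) h ≠ 0 := by
  have hM : ∀ c i h, melnikov (f + C c) G (α i) (β i) h =
      melnikov f G (α i) (β i) h + c * melnikov 1 G (α i) (β i) h := by
    intro c i h
    rw [melnikov_add, ← melnikov_C_mul, mul_one]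
  have hopen : IsOpen {c : ℝ | ∀ i, melnikov (f + C c) G (α i) (β i) (h₁ i) *
      melnikov (f + C c) G (α i) (β i) (h₂ i) < 0} := by
    rw [ofPred_forall]
    refine isOpen_iInter_of_finite fun i => ?_
    simp only [hM]
    exact isOpen_lt (by fun_prop) continuous_const
  have hne : {c : ℝ | ∀ i, melnikov (f + C c) G (α i) (β i) (h₁ i) *
      melnikov (f + C c) G (α i) (β i) (h₂ i) < 0}.Nonempty := ⟨0, fun i => by
    simpa using hc.sign i⟩
  have hae : ∀ᵐ c : ℝ, ∀ i, ∀ h ∈ Ioo (h₁ i) (h₂ i),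
      (-(melnikov f G (α i) (β i) / melnikov 1 G (α i) (β i))) h = c →
      deriv (-(melnikov f G (α i) (β i) / melnikov 1 G (α i) (β i))) h ≠ 0 := by
    refine MeasureTheory.ae_all_iff.mpr fun i => ae_forall_deriv_ne_of_eq fun h hh => ?_
    exact (((hc.isCell i).differentiableAt_melnikov f hh).div
      ((hc.isCell i).differentiableAt_melnikov 1 hh)
      ((hc.isCell i).melnikov_one_pos hh.1.le).ne').neg
  obtain ⟨c, hc1, hc2⟩ := (MeasureTheory.Measure.dense_of_ae hae).inter_open_nonempty _ hopen hne
  refine ⟨c, fun i => ?_⟩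
  have hlt := (hc.isCell i).lt
  obtain ⟨h, hh, h0⟩ : ∃ h ∈ Ioo (h₁ i) (h₂ i), melnikov (f + C c) G (α i) (β i) h = 0 := by
    have hcont := (continuous_melnikov (f + C c) G (α i) (β i)).continuousOn (s := Icc (h₁ i) (h₂ i))
    rcases mul_neg_iff.mp (hc1 i) with ⟨h3, h4⟩ | ⟨h3, h4⟩
    · exact intermediate_value_Ioo' hlt.le hcont ⟨h4, h3⟩
    · exact intermediate_value_Ioo hlt.le hcont ⟨h3, h4⟩
  refine ⟨h, hh, h0, fun hd => ?_⟩
  have hp := (hc.isCell i).melnikov_one_pos hh.1.le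
  have d1 := ((hc.isCell i).differentiableAt_melnikov f hh).hasDerivAt
  have d2 := ((hc.isCell i).differentiableAt_melnikov 1 hh).hasDerivAt
  rw [hM] at h0
  have d3 : deriv (melnikov (f + C c) G (α i) (β i)) h =
      deriv (melnikov f G (α i) (β i)) h + c * deriv (melnikov 1 G (α i) (β i)) h := by
    rw [show melnikov (f + C c) G (α i) (β i) =
      fun h => melnikov f G (α i) (β i) h + c * melnikov 1 G (α i) (β i) h from funext (hM c i)]
    exact (d1.add (d2.const_mul c)).deriv
  refine hc2 i h hh ?_ ?_
  · simp only [Pi.neg_apply, Pi.div_apply]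
    field_simp
    linarith
  · rw [(d1.div d2 hp.ne').neg.deriv, neg_eq_zero, div_eq_zero_iff]
    left
    rw [hd] at d3
    linear_combination (-melnikov 1 G (α i) (β i) h) * d3 - (deriv (melnikov 1 G (α i) (β i)) h) * h0

theorem hGe [Fintype ι] (hc : IsCellFamily f G α β h₁ h₂) {n m : ℕ} (hf : f.natDegree ≤ n)
    (hG : G.natDegree ≤ m + 1) : HGe n m (Fintype.card ι) := by
  classical
  obtain ⟨c, hz⟩ := hc.exists_simple_zeros
  choose h hh h0 h1 using hz
  have hev : ∀ᶠ ε in 𝓝[>] (0 : ℝ), ∀ i, ∃ Γ,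
      IsLimitCycle (lienard (f + C c) (derivative G) ε) Γ ∧
      ∀ p ∈ Γ, p.1 ∈ Ioo (α i) (β i) ∧ energy G p ∈ Ioo (h₁ i) (h₂ i) :=
    eventually_all.mpr fun i => (hc.isCell i).eventually_exists_limitCycle (hh i) (h0 i) (h1 i)
  obtain ⟨ε₀, hε₀, hsub⟩ := mem_nhdsGT_iff_exists_Ioc_subset.mp hev
  refine ⟨f + C c, derivative G, ?_, ?_, ε₀, hε₀, fun ε hε hle => ?_⟩
  · rwa [natDegree_add_C]
  · exact (natDegree_derivative_le G).trans (by omega)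
  · choose Γ hΓ hin using hsub ⟨hε, hle⟩
    refine ⟨Finset.univ.image Γ, by simpa using hΓ, ?_⟩
    rw [Finset.card_image_of_injective, Finset.card_univ]
    intro i j hij
    by_contra hne
    obtain ⟨⟨γ, -, -, -, hrange⟩, -⟩ := hΓ i
    have hp : γ 0 ∈ Γ i := hrange ▸ mem_range_self 0
    have h3 := hin i _ hp
    have h4 := hin j _ (hij ▸ hp)
    rcases hc.disjoint i j hne with h5 | h5
    · exact disjoint_left.mp h5 h3.1 h4.1
    · exact disjoint_left.mp h5 h3.2 h4.2

end IsCellFamily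

end Families

section Alternation

/-- A linearly independent family of functions on a set of reals has a linear combination that
alternates in sign along an increasing sequence of as many points as there are functions. -/
lemma exists_alternating {ι : Type} [Fintype ι] {k : ℕ} (hk : Fintype.card ι = k + 1)
    (m : ι → ℝ → ℝ) {I : Set ℝ}
    (hm : ∀ a : ι → ℝ, a ≠ 0 → ∃ h ∈ I, ∑ i, a i * m i h ≠ 0) :
    ∃ (a : ι → ℝ) (t : Fin (k + 1) → ℝ), StrictMono t ∧ (∀ i, t i ∈ I) ∧
      ∀ i : Fin k, (∑ j, a j * m j (t i.castSucc)) * (∑ j, a j * m j (t i.succ)) < 0 := by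
  classical
  have hpi : ∀ (φ : (ι → ℝ) →ₗ[ℝ] ℝ) (v : ι → ℝ), φ v = ∑ i, φ (Pi.single i 1) * v i := by
    intro φ v
    rw [φ.pi_apply_eq_sum_univ]
    refine Finset.sum_congr rfl fun i _ => ?_
    rw [smul_eq_mul, mul_comm]
    congr 2
    ext j
    simp [Pi.single_apply, eq_comm]
  let w : I → ι → ℝ := fun h i => m i h
  obtain ⟨κ, e, he, hspan, hli⟩ := exists_linearIndependent' ℝ w
  have htop : Submodule.span ℝ (Set.range (w ∘ e)) = ⊤ := by
    rw [hspan]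
    by_contra hne
    obtain ⟨φ, hφ, hker⟩ := Submodule.exists_le_ker_of_lt_top _ (lt_top_iff_ne_top.mpr hne)
    obtain ⟨h, hh, hsum⟩ := hm (fun i => φ (Pi.single i 1)) (fun h0 => hφ <| by
      refine LinearMap.pi_ext' fun i => ?_
      ext
      simpa using congrFun h0 i)
    apply hsum
    have h1 : φ (w ⟨h, hh⟩) = 0 := hker (Submodule.subset_span ⟨⟨h, hh⟩, rfl⟩)
    rw [← h1, hpi]
  let b : Module.Basis κ ℝ (ι → ℝ) := Module.Basis.mk hli htop.ge
  have : Fintype κ := FiniteDimensional.fintypeBasisIndex b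
  have hcard : Fintype.card κ = k + 1 := by
    rw [← Module.finrank_eq_card_basis b, Module.finrank_fintype_fun_eq_card, hk]
  have hinj : Function.Injective fun x => (e x : ℝ) := Subtype.val_injective.comp he
  have hs : (Finset.univ.image fun x => (e x : ℝ)).card = k + 1 := by
    rw [Finset.card_image_of_injective _ hinj, Finset.card_univ, hcard]
  set t := (Finset.univ.image fun x => (e x : ℝ)).orderEmbOfFin hs
  have ht : ∀ i, ∃ x, (e x : ℝ) = t i := fun i => by
    simpa only [Finset.mem_image, Finset.mem_univ, true_and] using Finset.orderEmbOfFin_mem _ hs i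
  choose x hx using ht
  have hxinj : Function.Injective x := fun i j hij => t.injective (by rw [← hx, ← hx, hij])
  let φ : (ι → ℝ) →ₗ[ℝ] ℝ := b.constr ℝ (Function.extend x (fun i => (-1 : ℝ) ^ (i : ℕ)) 0)
  have hφ : ∀ i, ∑ j, φ (Pi.single j 1) * m j (t i) = (-1) ^ (i : ℕ) := by
    intro i
    have h1 : φ (b (x i)) = (-1) ^ (i : ℕ) := by
      rw [Module.Basis.constr_basis, hxinj.extend_apply]
    rw [← h1, hpi φ (b (x i))]
    simp [b, w, hx]
  refine ⟨fun j => φ (Pi.single j 1), t, t.strictMono, fun i => hx i ▸ (e (x i)).2, fun i => ?_⟩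
  rw [hφ, hφ, ← pow_add]
  refine (Odd.neg_one_pow ⟨i, ?_⟩).trans_lt (by norm_num)
  simp
  ring

lemma disjoint_Ioo_castSucc_succ {k : ℕ} {t : Fin (k + 1) → ℝ} (ht : StrictMono t) {i j : Fin k}
    (hij : i ≠ j) :
    Disjoint (Set.Ioo (t i.castSucc) (t i.succ)) (Set.Ioo (t j.castSucc) (t j.succ)) := by
  have key : ∀ i j : Fin k, i < j →
      Disjoint (Set.Ioo (t i.castSucc) (t i.succ)) (Set.Ioo (t j.castSucc) (t j.succ)) := by
    intro i j hlt
    have : t i.succ ≤ t j.castSucc := ht.monotone (by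
      rw [Fin.le_def]
      exact hlt)
    exact Set.disjoint_left.mpr fun x hx hx' => by linarith [hx.2, hx'.1]
  rcases lt_or_gt_of_ne hij with h | h
  · exact key i j h
  · exact (key j i h).symm

end Alternation

section Outer

open Set Topology Real

lemma melnikov_reflect {f G : ℝ[X]} {σ : ℝ} (hG : ∀ x, G.eval (-x) = G.eval x)
    (hf : ∀ x, f.eval (-x) = σ * f.eval x) (α β h : ℝ) :
    melnikov f G (-β) (-α) h = σ * melnikov f G α β h := by
  unfold melnikov
  rw [← intervalIntegral.integral_comp_neg, ← intervalIntegral.integral_const_mul]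
  simp only [hG, hf, mul_assoc]

lemma melnikov_eq_zero_of_odd {f G : ℝ[X]} (hG : ∀ x, G.eval (-x) = G.eval x)
    (hf : ∀ x, f.eval (-x) = -f.eval x) (K h : ℝ) : melnikov f G (-K) K h = 0 := by
  have := melnikov_reflect (σ := -1) hG (by simpa using hf) (-K) K h
  rw [neg_neg] at this
  linarith

lemma melnikov_add_adjacent (f G : ℝ[X]) (a b c h : ℝ) :
    melnikov f G a b h + melnikov f G b c h = melnikov f G a c h :=
  intervalIntegral.integral_add_adjacent_intervals
    (Continuous.intervalIntegrable (by fun_prop) _ _)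
    (Continuous.intervalIntegrable (by fun_prop) _ _)

lemma melnikov_eq_zero_of_le {f G : ℝ[X]} {a b h : ℝ} (hab : a ≤ b)
    (hG : ∀ x ∈ Icc a b, h ≤ G.eval x) : melnikov f G a b h = 0 := by
  unfold melnikov
  rw [intervalIntegral.integral_congr (g := fun _ => 0), intervalIntegral.integral_zero]
  intro x hx
  rw [uIcc_of_le hab] at hx
  simp [Real.sqrt_eq_zero_of_nonpos (show 2 * (h - G.eval x) ≤ 0 by linarith [hG x hx])]

lemma melnikov_nonneg {f G : ℝ[X]} {a b : ℝ} (hab : a ≤ b)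
    (hf : ∀ x ∈ Icc a b, 0 ≤ f.eval x) (h : ℝ) : 0 ≤ melnikov f G a b h :=
  intervalIntegral.integral_nonneg hab fun x hx => mul_nonneg (hf x hx) (Real.sqrt_nonneg _)

lemma melnikov_symm_stable {f G : ℝ[X]} {K L h : ℝ} (hKL : K ≤ L)
    (hG : ∀ x, K ≤ |x| → h ≤ G.eval x) (hK : 0 ≤ K) :
    melnikov f G (-L) L h = melnikov f G (-K) K h := by
  rw [← melnikov_add_adjacent f G (-L) (-K) L, ← melnikov_add_adjacent f G (-K) K L,
    melnikov_eq_zero_of_le (by linarith), melnikov_eq_zero_of_le hKL]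
  · ring
  · exact fun x hx => hG x (hx.1.trans (le_abs_self x))
  · exact fun x hx => hG x (by rw [abs_of_nonpos (by linarith [hx.2])]; linarith [hx.2])

lemma exists_pos_le_eval {r : ℝ[X]} (hr : 0 < r.leadingCoeff) :
    ∃ c > 0, ∀ᶠ x in atTop, c ≤ r.eval x := by
  rcases Nat.eq_zero_or_pos r.natDegree with h | h
  · refine ⟨r.leadingCoeff, hr, Eventually.of_forall fun x => ?_⟩
    rw [eq_C_of_natDegree_eq_zero h]
    simp
  · exact ⟨1, one_pos, (r.tendsto_atTop_of_leadingCoeff_nonneg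
      (natDegree_pos_iff_degree_pos.mp h) hr.le).eventually_ge_atTop 1⟩

lemma eventually_melnikov_pos {f G : ℝ[X]} {X : ℝ} (hX : 0 < ∫ x in -X..X, f.eval x) :
    ∀ᶠ h in atTop, 0 < melnikov f G (-X) X h := by
  have hcont : Continuous fun τ : ℝ => ∫ x in -X..X, f.eval x * √(1 - τ * G.eval x) :=
    intervalIntegral.continuous_parametric_intervalIntegral_of_continuous' (by fun_prop) _ _
  have h1 := (hcont.tendsto 0).comp tendsto_inv_atTop_zero
  simp only [zero_mul, sub_zero, Real.sqrt_one, mul_one] at h1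
  filter_upwards [h1.eventually (lt_mem_nhds hX), eventually_gt_atTop 0] with h h2 h3
  have h4 : melnikov f G (-X) X h =
      √(2 * h) * ∫ x in -X..X, f.eval x * √(1 - h⁻¹ * G.eval x) := by
    rw [melnikov, ← intervalIntegral.integral_const_mul]
    refine intervalIntegral.integral_congr fun x _ => ?_
    rw [show 2 * (h - G.eval x) = (2 * h) * (1 - h⁻¹ * G.eval x) by field_simp,
      Real.sqrt_mul (by positivity)]
    ring
  rw [h4]
  exact mul_pos (Real.sqrt_pos.mpr (by positivity)) h2

lemma exists_melnikov_even_pos {r G : ℝ[X]} (hr : 0 < r.leadingCoeff) {κ : ℝ → ℝ}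
    (hκ : ∀ h x, κ h ≤ |x| → h ≤ G.eval x) (hκ0 : ∀ h, 0 ≤ κ h) :
    ∀ᶠ h in atTop, 0 < melnikov (r.comp (X ^ 2)) G (-κ h) (κ h) h := by
  obtain ⟨c, hc, hev⟩ := exists_pos_le_eval hr
  obtain ⟨x₀, hx₀⟩ := eventually_atTop.mp hev
  set f : ℝ[X] := r.comp (X ^ 2) with hf
  set Y : ℝ := max 1 x₀ with hY
  have hY1 : 1 ≤ Y := le_max_left _ _
  have hfc : ∀ x, Y ≤ |x| → c ≤ f.eval x := by
    intro x hx
    simp only [hf, eval_comp, eval_pow, eval_X]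
    refine hx₀ _ ?_
    have : x₀ ≤ Y := le_max_right _ _
    nlinarith [sq_abs x]
  have hii : ∀ a b, IntervalIntegrable (fun x => f.eval x) MeasureTheory.volume a b :=
    fun a b => f.continuous.intervalIntegrable a b
  obtain ⟨Z, hZY, hZ⟩ : ∃ Z, Y ≤ Z ∧ 0 < ∫ x in -Z..Z, f.eval x := by
    set I := ∫ x in -Y..Y, f.eval x with hI
    refine ⟨Y + (|I| + 1) / c, by have : 0 ≤ (|I| + 1) / c := by positivity
                                  linarith, ?_⟩
    set Z := Y + (|I| + 1) / c with hZ
    have hYZ : Y ≤ Z := by have : 0 ≤ (|I| + 1) / c := by positivity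
                           linarith
    have h1 : c * (Z - Y) ≤ ∫ x in Y..Z, f.eval x := by
      have := intervalIntegral.integral_mono_on hYZ intervalIntegrable_const (hii Y Z)
        (fun x hx => hfc x (hx.1.trans (le_abs_self x)))
      simpa [mul_comm] using this
    have h2 : 0 ≤ ∫ x in -Z..-Y, f.eval x :=
      intervalIntegral.integral_nonneg (by linarith) fun x hx => hc.le.trans
        (hfc x (by rw [abs_of_nonpos (by linarith [hx.2])]; linarith [hx.2]))
    have h3 : c * (Z - Y) = |I| + 1 := by rw [hZ]; field_simp; ring
    rw [← intervalIntegral.integral_add_adjacent_intervals (hii (-Z) (-Y)) (hii (-Y) Z),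
      ← intervalIntegral.integral_add_adjacent_intervals (hii (-Y) Y) (hii Y Z)]
    linarith [neg_abs_le I]
  filter_upwards [eventually_melnikov_pos (G := G) hZ] with h hh
  have hstab := melnikov_symm_stable (f := f) (le_max_left (κ h) Z) (hκ h) (hκ0 h)
  rw [← hstab]
  set L := max (κ h) Z
  have hZL : Z ≤ L := le_max_right _ _
  rw [← melnikov_add_adjacent f G (-L) (-Z) L, ← melnikov_add_adjacent f G (-Z) Z L]
  have h1 : 0 ≤ melnikov f G Z L h := melnikov_nonneg hZL (fun x hx => hc.le.trans
    (hfc x ((hZY.trans hx.1).trans (le_abs_self x)))) h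
  have h2 : 0 ≤ melnikov f G (-L) (-Z) h := melnikov_nonneg (by linarith) (fun x hx => hc.le.trans
    (hfc x (by rw [abs_of_nonpos (by linarith [hx.2])]; linarith [hx.2]))) h
  linarith

lemma exists_melnikov_even_ne_zero {r G : ℝ[X]} (hr : r ≠ 0) {κ : ℝ → ℝ}
    (hκ : ∀ h x, κ h ≤ |x| → h ≤ G.eval x) (hκ0 : ∀ h, 0 ≤ κ h) :
    ∀ᶠ h in atTop, melnikov (r.comp (X ^ 2)) G (-κ h) (κ h) h ≠ 0 := by
  rcases (leadingCoeff_ne_zero.mpr hr).lt_or_gt with h | h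
  · have h1 : 0 < (C (-1) * r).leadingCoeff := by simpa using h
    filter_upwards [exists_melnikov_even_pos h1 hκ hκ0] with x hx
    rw [mul_comp, C_comp, melnikov_C_mul] at hx
    intro h0
    rw [h0] at hx
    simp at hx
  · filter_upwards [exists_melnikov_even_pos h hκ hκ0] with x hx using hx.ne'

/-- The region outside of a large oval of an even potential is a cell. -/
lemma exists_outer_cells {G : ℝ[X]} (hG : ∀ x, G.eval (-x) = G.eval x) (hd : 2 ≤ G.natDegree)
    (hl : 0 < G.leadingCoeff) :
    ∃ H, ∀ h₁ h₂, H < h₁ → h₁ < h₂ → ∀ᶠ K in atTop, IsCell G (-K) K h₁ h₂ := by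
  have hG' : ∀ x, (derivative G).eval (-x) = -(derivative G).eval x := by
    have : G.comp (-X) = G := Polynomial.funext fun x => by simp [hG]
    intro x
    have h1 := congrArg (fun P => (derivative P).eval x) this
    simp only [derivative_comp, derivative_neg, derivative_X, eval_mul, eval_comp, eval_neg,
      eval_one, eval_X] at h1
    linarith
  have ht : Tendsto (fun x => (derivative G).eval x) atTop atTop := by
    refine tendsto_atTop_of_leadingCoeff_nonneg _ ?_ ?_
    · rw [← natDegree_pos_iff_degree_pos, natDegree_derivative]
      omega
    · rw [leadingCoeff_derivative]
      positivity
  have htG : Tendsto (fun x => G.eval x) atTop atTop :=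
    tendsto_atTop_of_leadingCoeff_nonneg _ (natDegree_pos_iff_degree_pos.mp (by omega)) hl.le
  obtain ⟨x₁, hx₁⟩ := eventually_atTop.mp ((ht.eventually_gt_atTop 0).and (eventually_ge_atTop 0))
  obtain ⟨H, hH⟩ := (isCompact_Icc (a := -x₁) (b := x₁)).bddAbove_image G.continuous.continuousOn
  refine ⟨H, fun h₁ h₂ hH1 h12 => ?_⟩
  filter_upwards [eventually_gt_atTop x₁, htG.eventually_gt_atTop h₂] with K hK hK2
  have hx0 : 0 ≤ x₁ := (hx₁ x₁ le_rfl).2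
  refine ⟨h12, by rwa [hG], hK2, -x₁, x₁, by linarith, by linarith, hK, fun x hx => ?_,
    fun x hx => (hx₁ x hx.1).1, fun x hx => (hH ⟨x, hx, rfl⟩).trans_lt hH1⟩
  have := (hx₁ (-x) (by linarith [hx.2])).1
  rw [hG'] at this
  linarith

/-- An even potential carries, beyond any level, `k` nested outer cells across which the Melnikov
function of some even polynomial of degree at most `2 * k` changes sign. -/
lemma exists_outer_family {G : ℝ[X]} (hG : ∀ x, G.eval (-x) = G.eval x) (hd : 2 ≤ G.natDegree)
    (hl : 0 < G.leadingCoeff) (k : ℕ) (H : ℝ) :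
    ∃ (f : ℝ[X]) (t : Fin (k + 1) → ℝ) (K : ℝ), f.natDegree ≤ 2 * k ∧
      StrictMono t ∧ (∀ i, H < t i) ∧ ∀ i : Fin k, IsCell G (-K) K (t i.castSucc) (t i.succ) ∧
        melnikov f G (-K) K (t i.castSucc) * melnikov f G (-K) K (t i.succ) < 0 := by
  have htG : Tendsto (fun x => G.eval x) atTop atTop :=
    tendsto_atTop_of_leadingCoeff_nonneg _ (natDegree_pos_iff_degree_pos.mp (by omega)) hl.le
  obtain ⟨H₀, hH₀⟩ := exists_outer_cells hG hd hl
  have hκ : ∀ h, ∃ κ, 0 ≤ κ ∧ ∀ x, κ ≤ |x| → h ≤ G.eval x := by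
    intro h
    obtain ⟨κ, hκ⟩ := eventually_atTop.mp (htG.eventually_ge_atTop h)
    refine ⟨max κ 0, le_max_right _ _, fun x hx => ?_⟩
    have := hκ |x| ((le_max_left _ _).trans hx)
    rcases abs_choice x with h1 | h1 <;> rw [h1] at this
    · exact this
    · rwa [hG] at this
  choose κ hκ0 hκ using hκ
  have hsum : ∀ (a : Fin (k + 1) → ℝ) (K h : ℝ),
      melnikov ((∑ i, C (a i) * X ^ (i : ℕ)).comp (X ^ 2)) G (-K) K h =
      ∑ i, a i * melnikov ((X ^ (i : ℕ)).comp (X ^ 2)) G (-K) K h := by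
    intro a K h
    simp only [← melnikov_C_mul]
    generalize (Finset.univ : Finset (Fin (k + 1))) = s
    classical
    induction s using Finset.induction_on with
    | empty => simp [melnikov]
    | insert i s hi ih =>
      rw [Finset.sum_insert hi, Finset.sum_insert hi, add_comp, melnikov_add, ih, mul_comp, C_comp]
  obtain ⟨a, t, htmono, htI, hsign⟩ := exists_alternating (k := k) (Fintype.card_fin _)
    (fun i h => melnikov ((X ^ (i : ℕ)).comp (X ^ 2)) G (-κ h) (κ h) h) (I := Ioi (max H H₀)) (by
      intro a ha
      have hr : ∑ i, C (a i) * X ^ (i : ℕ) ≠ 0 := by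
        obtain ⟨i, hi⟩ := Function.ne_iff.mp ha
        intro h0
        apply hi
        have h1 := congrArg (fun P => coeff P (i : ℕ)) h0
        simpa [finsetSum_coeff, coeff_X_pow, Fin.val_inj] using h1
      obtain ⟨h, h1, h2⟩ := ((exists_melnikov_even_ne_zero hr hκ hκ0).and
        (eventually_gt_atTop (max H H₀))).exists
      exact ⟨h, h2, by rwa [hsum] at h1⟩)
  simp only [← hsum] at hsign
  obtain ⟨K, hK1, hK2⟩ := ((eventually_all.mpr fun i : Fin k => hH₀ _ _
    ((le_max_right _ _).trans_lt (htI i.castSucc)) (htmono i.castSucc_lt_succ)).and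
    (eventually_all.mpr fun i : Fin (k + 1) => eventually_ge_atTop (κ (t i)))).exists
  refine ⟨(∑ i, C (a i) * X ^ (i : ℕ)).comp (X ^ 2), t, K, ?_, htmono,
    fun i => (le_max_left _ _).trans_lt (htI i), fun i => ⟨hK1 i, ?_⟩⟩
  · rw [natDegree_comp, natDegree_X_pow, mul_comm]
    refine Nat.mul_le_mul_left 2 (natDegree_sum_le_of_forall_le _ _ fun i _ => ?_)
    exact (natDegree_C_mul_X_pow_le _ _).trans (by omega)
  · rw [melnikov_symm_stable (hK2 _) (hκ _) (hκ0 _), melnikov_symm_stable (hK2 _) (hκ _) (hκ0 _)]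
    exact hsign i

end Outer

section Doubling

open Set Topology Real

namespace IsCell

variable {G : ℝ[X]} {α β h₁ h₂ s : ℝ}

lemma lt_endpoints (hc : IsCell G α β h₁ h₂) : α < β := by
  obtain ⟨a₁, b₁, h1, h2, h3, -⟩ := hc.exists_core
  linarith

lemma comp_square (hc : IsCell G α β h₁ h₂) (hs : 0 < s + α) :
    IsCell (G.comp (X ^ 2 - C s)) √(s + α) √(s + β) h₁ h₂ := by
  have hαβ := hc.lt_endpoints
  obtain ⟨a₁, b₁, h1, h2, h3, h4, h5, h6⟩ := hc.exists_core
  have hsq : ∀ x, 0 ≤ s + x → √(s + x) ^ 2 - s = x := fun x hx => by rw [Real.sq_sqrt hx]; ring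
  have hmem : ∀ {u v x : ℝ}, 0 < s + u → u ≤ v → x ∈ Icc √(s + u) √(s + v) →
      0 < x ∧ x ^ 2 - s ∈ Icc u v := by
    intro u v x hu huv hx
    have hx0 : 0 < x := (Real.sqrt_pos.mpr hu).trans_le hx.1
    have h7 := (Real.sqrt_le_left hx0.le).mp hx.1
    have h8 := (Real.le_sqrt' hx0).mp hx.2
    exact ⟨hx0, by linarith, by linarith⟩
  have hd : ∀ x, (derivative (G.comp (X ^ 2 - C s))).eval x =
      2 * x * (derivative G).eval (x ^ 2 - s) := by
    intro x
    simp [derivative_comp]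
    norm_num
  refine ⟨hc.lt, ?_, ?_, √(s + a₁), √(s + b₁), Real.sqrt_lt_sqrt hs.le (by linarith),
    Real.sqrt_le_sqrt (by linarith), Real.sqrt_lt_sqrt (by linarith) (by linarith),
    fun x hx => ?_, fun x hx => ?_, fun x hx => ?_⟩
  · simpa [hsq α hs.le] using hc.lt_left
  · simpa [hsq β (by linarith)] using hc.lt_right
  · obtain ⟨hx0, hx1⟩ := hmem hs h1.le hx
    rw [hd]
    exact mul_neg_of_pos_of_neg (by positivity) (h4 _ hx1)
  · obtain ⟨hx0, hx1⟩ := hmem (by linarith) h3.le hx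
    rw [hd]
    exact mul_pos (by positivity) (h5 _ hx1)
  · obtain ⟨hx0, hx1⟩ := hmem (by linarith) h2 hx
    simpa using h6 _ hx1

lemma reflect (hc : IsCell G α β h₁ h₂) (hG : ∀ x, G.eval (-x) = G.eval x)
    (hG' : ∀ x, (derivative G).eval (-x) = -(derivative G).eval x) :
    IsCell G (-β) (-α) h₁ h₂ := by
  obtain ⟨a₁, b₁, h1, h2, h3, h4, h5, h6⟩ := hc.exists_core
  refine ⟨hc.lt, by rw [hG]; exact hc.lt_right, by rw [hG]; exact hc.lt_left, -b₁, -a₁,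
    by linarith, by linarith, by linarith, fun x hx => ?_, fun x hx => ?_, fun x hx => ?_⟩
  · have := h5 (-x) ⟨by linarith [hx.2], by linarith [hx.1]⟩
    rw [hG'] at this
    linarith
  · have := h4 (-x) ⟨by linarith [hx.2], by linarith [hx.1]⟩
    rw [hG'] at this
    linarith
  · have := h6 (-x) ⟨by linarith [hx.2], by linarith [hx.1]⟩
    rwa [hG] at this

lemma melnikov_comp_square (hc : IsCell G α β h₁ h₂) (hs : 0 < s + α) (f : ℝ[X]) (h : ℝ) :
    melnikov (2 * X * f.comp (X ^ 2 - C s)) (G.comp (X ^ 2 - C s)) √(s + α) √(s + β) h =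
      melnikov f G α β h := by
  have hαβ := hc.lt_endpoints
  have := intervalIntegral.integral_comp_mul_deriv (a := √(s + α)) (b := √(s + β))
    (f := fun x => x ^ 2 - s) (f' := fun x => 2 * x)
    (g := fun y => f.eval y * √(2 * (h - G.eval y)))
    (fun x _ => by simpa using (hasDerivAt_pow 2 x).sub_const s) (by fun_prop) (by fun_prop)
  simp only [Real.sq_sqrt hs.le, Real.sq_sqrt (show 0 ≤ s + β by linarith), add_sub_cancel_left]
    at this
  rw [melnikov, melnikov, ← this]
  refine intervalIntegral.integral_congr fun x _ => ?_
  simp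
  ring

end IsCell

/-- Doubling of a family of cells by the substitution `x ↦ x ^ 2 - s`. -/
theorem IsCellFamily.exists_double {ι : Type} [Finite ι] {f G : ℝ[X]} {α β h₁ h₂ : ι → ℝ}
    (hc : IsCellFamily f G α β h₁ h₂) (hd : 1 ≤ G.natDegree) (hl : 0 < G.leadingCoeff)
    {n k : ℕ} (hn : 2 * f.natDegree + 1 ≤ n) (hk : 2 * k ≤ n) :
    ∃ (F P : ℝ[X]) (a b u v : (ι ⊕ ι) ⊕ Fin k → ℝ), IsCellFamily F P a b u v ∧
      F.natDegree ≤ n ∧ P.natDegree = 2 * G.natDegree ∧ 0 < P.leadingCoeff := by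
  obtain ⟨s, hs⟩ : ∃ s : ℝ, ∀ i, 0 < s + α i := by
    obtain ⟨s, hs⟩ := (eventually_all.mpr fun i => eventually_gt_atTop (-α i)).exists
    exact ⟨s, fun i => by linarith [hs i]⟩
  have hq : (X ^ 2 - C s : ℝ[X]).natDegree = 2 := natDegree_X_pow_sub_C
  have hql : (X ^ 2 - C s : ℝ[X]).leadingCoeff = 1 := leadingCoeff_X_pow_sub_C two_pos
  set P := G.comp (X ^ 2 - C s) with hP
  have hPd : P.natDegree = 2 * G.natDegree := by rw [hP, natDegree_comp, hq, mul_comm]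
  have hPl : 0 < P.leadingCoeff := by
    rw [hP, leadingCoeff_comp (by rw [hq]; norm_num), hql]
    simpa using hl
  have hPe : ∀ x, P.eval (-x) = P.eval x := fun x => by simp [hP]
  have hPe' : ∀ x, (derivative P).eval (-x) = -(derivative P).eval x := fun x => by
    simp [hP, derivative_comp]
  obtain ⟨H, hH⟩ : ∃ H, ∀ i, h₂ i < H :=
    (eventually_all.mpr fun i => eventually_gt_atTop (h₂ i)).exists
  obtain ⟨f₂, t, K, hf₂, htmono, htH, hout⟩ := exists_outer_family hPe (by omega) hPl k H
  set f₁ : ℝ[X] := 2 * X * f.comp (X ^ 2 - C s) with hf₁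
  have hf₁o : ∀ x, f₁.eval (-x) = -f₁.eval x := fun x => by simp [hf₁]
  have hM : ∀ δ a b h, melnikov (f₁ + C δ * f₂) P a b h =
      melnikov f₁ P a b h + δ * melnikov f₂ P a b h := fun δ a b h => by
    rw [melnikov_add, melnikov_C_mul]
  have hM1 : ∀ i h, melnikov f₁ P √(s + α i) √(s + β i) h = melnikov f G (α i) (β i) h :=
    fun i h => (hc.isCell i).melnikov_comp_square (hs i) f h
  have hM2 : ∀ i h, melnikov f₁ P (-√(s + β i)) (-√(s + α i)) h =
      -melnikov f G (α i) (β i) h := fun i h => by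
    rw [melnikov_reflect (σ := -1) hPe (by simpa using hf₁o), hM1]
    ring
  have hδ : ∀ᶠ δ in 𝓝[≠] (0 : ℝ), ∀ i,
      melnikov (f₁ + C δ * f₂) P √(s + α i) √(s + β i) (h₁ i) *
        melnikov (f₁ + C δ * f₂) P √(s + α i) √(s + β i) (h₂ i) < 0 ∧
      melnikov (f₁ + C δ * f₂) P (-√(s + β i)) (-√(s + α i)) (h₁ i) *
        melnikov (f₁ + C δ * f₂) P (-√(s + β i)) (-√(s + α i)) (h₂ i) < 0 := by
    refine eventually_all.mpr fun i => nhdsWithin_le_nhds ?_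
    simp only [hM, hM1, hM2]
    refine Filter.Eventually.and ?_ ?_
    · refine ContinuousAt.eventually_lt (by fun_prop) continuousAt_const ?_
      simpa using hc.sign i
    · refine ContinuousAt.eventually_lt (by fun_prop) continuousAt_const ?_
      simpa using hc.sign i
  obtain ⟨δ, hδ, hδ0⟩ := (hδ.and self_mem_nhdsWithin).exists
  have hδ0 : δ ≠ 0 := hδ0
  have hpos : ∀ i, 0 < √(s + α i) := fun i => Real.sqrt_pos.mpr (hs i)
  have hxdisj : ∀ i j, Disjoint (Ioo (α i) (β i)) (Ioo (α j) (β j)) →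
      Disjoint (Ioo √(s + α i) √(s + β i)) (Ioo √(s + α j) √(s + β j)) := by
    intro i j hij
    refine disjoint_left.mpr fun x hx hx' => 
      disjoint_left.mp hij (show x ^ 2 - s ∈ Ioo _ _ from ?_) ?_
    · have hx0 := (hpos i).trans hx.1
      exact ⟨by linarith [(Real.sqrt_lt' hx0).mp hx.1], by linarith [(Real.lt_sqrt hx0.le).mp hx.2]⟩
    · have hx0 := (hpos i).trans hx.1
      exact ⟨by linarith [(Real.sqrt_lt' hx0).mp hx'.1],
        by linarith [(Real.lt_sqrt hx0.le).mp hx'.2]⟩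
  have hneg : ∀ {a b c d : ℝ}, Disjoint (Ioo a b) (Ioo c d) →
      Disjoint (Ioo (-b) (-a)) (Ioo (-d) (-c)) := by
    intro a b c d h
    refine disjoint_left.mpr fun x hx hx' => 
      disjoint_left.mp h (show -x ∈ Ioo _ _ from ?_) ?_
    · exact ⟨by linarith [hx.2], by linarith [hx.1]⟩
    · exact ⟨by linarith [hx'.2], by linarith [hx'.1]⟩
  have hposneg : ∀ i j, Disjoint (Ioo √(s + α i) √(s + β i))
      (Ioo (-√(s + β j)) (-√(s + α j))) := fun i j =>
    disjoint_left.mpr fun x hx hx' => by linarith [hx.1, hx'.2, hpos i, hpos j]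
  have hinout : ∀ i (l : Fin k), Disjoint (Ioo (h₁ i) (h₂ i)) (Ioo (t l.castSucc) (t l.succ)) :=
    fun i l => disjoint_left.mpr fun x hx hx' => by
      linarith [hx.2, hx'.1, hH i, htH l.castSucc]
  refine ⟨f₁ + C δ * f₂, P,
    Sum.elim (Sum.elim (fun i => √(s + α i)) (fun i => -√(s + β i))) (fun _ => -K),
    Sum.elim (Sum.elim (fun i => √(s + β i)) (fun i => -√(s + α i))) (fun _ => K),
    Sum.elim (Sum.elim h₁ h₁) (fun l => t l.castSucc),
    Sum.elim (Sum.elim h₂ h₂) (fun l => t l.succ), ⟨?_, ?_, ?_⟩, ?_, hPd, hPl⟩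
  · rintro ((i | i) | l)
    · exact (hc.isCell i).comp_square (hs i)
    · exact ((hc.isCell i).comp_square (hs i)).reflect hPe hPe'
    · exact (hout l).1
  · rintro ((i | i) | l) ((j | j) | l') hne
    · exact (hc.disjoint i j (by simpa using hne)).imp_left (hxdisj i j)
    · exact Or.inl (hposneg i j)
    · exact Or.inr (hinout i l')
    · exact Or.inl (hposneg j i).symm
    · exact (hc.disjoint i j (by simpa using hne)).imp_left fun h => hneg (hxdisj i j h)
    · exact Or.inr (hinout i l')
    · exact Or.inr (hinout j l).symm
    · exact Or.inr (hinout j l).symm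
    · exact Or.inr (disjoint_Ioo_castSucc_succ htmono (by simpa using hne))
  · rintro ((i | i) | l)
    · exact (hδ i).1
    · exact (hδ i).2
    · simp only [Sum.elim_inr, hM, melnikov_eq_zero_of_odd hPe hf₁o, zero_add]
      have := (hout l).2
      nlinarith [mul_neg_of_pos_of_neg (show 0 < δ ^ 2 by positivity) this]
  · refine natDegree_add_le_of_degree_le ?_ ((natDegree_C_mul_le _ _).trans (hf₂.trans hk))
    refine natDegree_mul_le.trans ?_
    rw [natDegree_comp, hq]
    have : (2 * X : ℝ[X]).natDegree ≤ 1 :=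
      natDegree_mul_le.trans (by simp)
    omega

end Doubling

section Base

open Set Topology Real

lemma eval_chebyshev_three (x : ℝ) : (Chebyshev.T ℝ 3).eval x = 4 * x ^ 3 - 3 * x := by
  have h := Chebyshev.T_add_two ℝ 1
  norm_num [Chebyshev.T_two] at h
  rw [h]
  simp
  ring

lemma eval_derivative_chebyshev_three (x : ℝ) :
    (derivative (Chebyshev.T ℝ 3)).eval x = 12 * x ^ 2 - 3 := by
  have h : Chebyshev.T ℝ 3 = 4 * X ^ 3 - 3 * X := Polynomial.funext fun x => by
    simp [eval_chebyshev_three]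
  rw [h]
  simp
  ring

lemma isCell_chebyshev_three {h₁ h₂ : ℝ} (h1 : -1 < h₁) (h12 : h₁ < h₂) (h2 : h₂ < 0) :
    IsCell (Chebyshev.T ℝ 3) 0 (cos (π / 6)) h₁ h₂ := by
  have hβ : cos (π / 6) ^ 2 = 3 / 4 := by
    rw [cos_pi_div_six, div_pow, Real.sq_sqrt (by norm_num)]
    norm_num
  have hβ0 : 0 < cos (π / 6) := by
    rw [cos_pi_div_six]
    positivity
  have hev : ∀ᶠ x in 𝓝 (1 / 2 : ℝ), (Chebyshev.T ℝ 3).eval x < h₁ := by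
    refine (Chebyshev.T ℝ 3).continuous.continuousAt.eventually_lt continuousAt_const ?_
    rw [eval_chebyshev_three]
    linarith
  obtain ⟨η, hη, hball⟩ := Metric.eventually_nhds_iff.mp hev
  set e := min (η / 2) (1 / 4) with he
  have he0 : 0 < e := lt_min (by linarith) (by norm_num)
  have he1 : e ≤ η / 2 := min_le_left _ _
  have he2 : e ≤ 1 / 4 := min_le_right _ _
  refine ⟨h12, ?_, ?_, 1 / 2 - e, 1 / 2 + e, by linarith, by linarith, by nlinarith,
    fun x hx => ?_, fun x hx => ?_, fun x hx => hball ?_⟩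
  · rw [eval_chebyshev_three]
    linarith
  · rw [eval_chebyshev_three, show 4 * cos (π / 6) ^ 3 - 3 * cos (π / 6) =
      cos (π / 6) * (4 * cos (π / 6) ^ 2 - 3) by ring, hβ]
    linarith
  · rw [eval_derivative_chebyshev_three]
    nlinarith [hx.1, hx.2]
  · rw [eval_derivative_chebyshev_three]
    nlinarith [hx.1, hx.2]
  · rw [Real.dist_eq, abs_lt]
    constructor <;> linarith [hx.1, hx.2]

lemma melnikov_chebyshev (k : ℕ) (h : ℝ) :
    melnikov (Chebyshev.U ℝ (k - 1)) (Chebyshev.T ℝ 3) 0 (cos (π / 6)) h =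
      ∫ w in -(π / 6)..π / 6,
        sin (k * (π / 3)) * (Chebyshev.T ℝ k).eval (cos w) * √(2 * (h + cos (3 * w))) := by
  have hsub := intervalIntegral.integral_comp_mul_deriv (a := -(π / 6)) (b := π / 6)
    (f := fun w => cos (π / 3 - w)) (f' := fun w => sin (π / 3 - w))
    (g := fun x => (Chebyshev.U ℝ (k - 1)).eval x * √(2 * (h - (Chebyshev.T ℝ 3).eval x)))
    (fun w _ => by simpa using (hasDerivAt_id w).const_sub (π / 3) |>.cos) (by fun_prop)
    (by fun_prop)
  simp only [show π / 3 - -(π / 6) = π / 2 by ring, show π / 3 - π / 6 = π / 6 by ring,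
    cos_pi_div_two] at hsub
  rw [melnikov, ← hsub]
  have hodd : ∫ w in -(π / 6)..π / 6, cos (k * (π / 3)) * sin (k * w) *
      √(2 * (h + cos (3 * w))) = 0 := by
    have := intervalIntegral.integral_comp_neg (a := -(π / 6)) (b := π / 6)
      (fun w => cos (k * (π / 3)) * sin (k * w) * √(2 * (h + cos (3 * w))))
    simp only [mul_neg, sin_neg, cos_neg, neg_mul, intervalIntegral.integral_neg, neg_neg] at this
    linarith
  rw [← sub_zero (∫ w in -(π / 6)..π / 6, sin (k * (π / 3)) * _ * _), ← hodd,
    ← intervalIntegral.integral_sub (Continuous.intervalIntegrable (by fun_prop) _ _)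
      (Continuous.intervalIntegrable (by fun_prop) _ _)]
  refine intervalIntegral.integral_congr fun w _ => ?_
  have hU := Chebyshev.U_real_cos (π / 3 - w) (k - 1)
  have hT := Chebyshev.T_real_cos (π / 3 - w) 3
  have hTk := Chebyshev.T_real_cos w k
  push_cast at hU hT hTk
  rw [show 3 * (π / 3 - w) = π - 3 * w by ring, cos_pi_sub] at hT
  rw [show ((k : ℝ) - 1 + 1) * (π / 3 - w) = k * (π / 3) - k * w by ring, sin_sub (k * (π / 3))] at hU
  simp only [Function.comp_apply, hT, hTk, sub_neg_eq_add]
  linear_combination √(2 * (h + cos (3 * w))) * hU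

lemma exists_sign_left {F : ℝ[X]} (hF : F ≠ 0) :
    ∃ s c : ℝ, c < 1 ∧ (∀ y ∈ Ioo c 1, 0 < s * F.eval y) ∧ 0 ≤ s * F.eval 1 := by
  obtain ⟨Q, hQ, hnd⟩ := exists_eq_pow_rootMultiplicity_mul_and_not_dvd F hF 1
  set m := F.rootMultiplicity 1
  have hQ1 : Q.eval 1 ≠ 0 := fun h => hnd (dvd_iff_isRoot.mpr h)
  have hev : ∀ᶠ y in 𝓝 (1 : ℝ), 0 < Q.eval 1 * Q.eval y := by
    refine continuousAt_const.eventually_lt (by fun_prop) ?_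
    exact mul_self_pos.mpr hQ1
  obtain ⟨η, hη, hball⟩ := Metric.eventually_nhds_iff.mp hev
  have hF : ∀ y, (-1) ^ m * Q.eval 1 * F.eval y = (1 - y) ^ m * (Q.eval 1 * Q.eval y) := by
    intro y
    rw [hQ, eval_mul, eval_pow, eval_sub, eval_X, eval_C,
      show (1 - y) = (-1) * (y - 1) by ring, mul_pow]
    ring
  refine ⟨(-1) ^ m * Q.eval 1, 1 - η, by linarith, fun y hy => ?_, ?_⟩
  · rw [hF]
    refine mul_pos (pow_pos (by linarith [hy.2]) _) (hball ?_)
    rw [Real.dist_eq, abs_lt]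
    constructor <;> linarith [hy.1, hy.2]
  · rw [hF]
    exact mul_nonneg (by simp) (mul_self_nonneg _)

lemma exists_integral_ne_zero {F : ℝ[X]} (hF : F ≠ 0) : ∃ h ∈ Ioo (-1 : ℝ) 0,
    ∫ w in -(π / 6)..π / 6, F.eval (cos w) * √(2 * (h + cos (3 * w))) ≠ 0 := by
  obtain ⟨s, c, hc, hpos, h1⟩ := exists_sign_left hF
  have hπ := pi_pos
  have hev : ∀ᶠ w in 𝓝 (0 : ℝ), c < cos w ∧ w < π / 6 := by
    refine Filter.Eventually.and ?_ (gt_mem_nhds (by positivity))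
    exact continuousAt_const.eventually_lt continuous_cos.continuousAt (by simpa using hc)
  obtain ⟨δ, ⟨hδ1, hδ2⟩, hδ0⟩ :=
    ((hev.filter_mono nhdsWithin_le_nhds).and (self_mem_nhdsWithin (s := Ioi (0 : ℝ)))).exists
  have hδ0 : 0 < δ := hδ0
  have hlt : cos (3 * δ) < 1 := by
    rw [← cos_zero]
    exact cos_lt_cos_of_nonneg_of_le_pi le_rfl (by linarith) (by linarith)
  have hgt : 0 < cos (3 * δ) := cos_pos_of_mem_Ioo ⟨by linarith, by linarith⟩
  have hlt1 : ∀ w, w ≠ 0 → |w| ≤ π / 6 → cos w < 1 := by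
    intro w hw hw6
    rw [← cos_zero, ← cos_abs w]
    exact cos_lt_cos_of_nonneg_of_le_pi le_rfl (by linarith) (abs_pos.mpr hw)
  have hgtc : ∀ w, |w| ≤ δ → c < cos w := by
    intro w hw
    rw [← cos_abs w]
    exact hδ1.trans_le (cos_le_cos_of_nonneg_of_le_pi (abs_nonneg w) (by linarith) hw)
  refine ⟨-cos (3 * δ), ⟨by linarith, by linarith⟩, fun h0 => ?_⟩
  have hintg : 0 < ∫ w in -(π / 6)..π / 6,
      s * F.eval (cos w) * √(2 * (-cos (3 * δ) + cos (3 * w))) := by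
    refine intervalIntegral.integral_pos (by linarith) (by fun_prop) (fun w hw => ?_)
      ⟨δ / 2, ⟨by linarith, by linarith⟩, ?_⟩
    · have hw6 : |w| ≤ π / 6 := abs_le.mpr ⟨hw.1.le, hw.2⟩
      rcases le_total |w| δ with hwδ | hwδ
      · refine mul_nonneg ?_ (Real.sqrt_nonneg _)
        rcases eq_or_ne w 0 with rfl | hw0
        · simpa using h1
        · exact (hpos _ ⟨hgtc w hwδ, hlt1 w hw0 hw6⟩).le
      · rw [Real.sqrt_eq_zero_of_nonpos, mul_zero]
        have : cos (3 * w) ≤ cos (3 * δ) := by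
          rw [← cos_abs (3 * w), abs_mul, abs_of_pos (show (0 : ℝ) < 3 by norm_num)]
          exact cos_le_cos_of_nonneg_of_le_pi (by linarith) (by linarith) (by linarith)
        linarith
    · have habs : |δ / 2| = δ / 2 := abs_of_pos (by linarith)
      refine mul_pos (hpos _ ⟨hgtc _ (by rw [habs]; linarith),
        hlt1 _ (by linarith) (by rw [habs]; linarith)⟩) (Real.sqrt_pos.mpr ?_)
      have : cos (3 * δ) < cos (3 * (δ / 2)) :=
        cos_lt_cos_of_nonneg_of_le_pi (by linarith) (by linarith) (by linarith)
      linarith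
  simp only [mul_assoc, intervalIntegral.integral_const_mul, h0, mul_zero, lt_irrefl] at hintg

theorem exists_chebyshev_family (n : ℕ) :
    ∃ (f : ℝ[X]) (α β h₁ h₂ : Fin (n - (n + 1) / 3) → ℝ),
      IsCellFamily f (Chebyshev.T ℝ 3) α β h₁ h₂ ∧ f.natDegree ≤ n := by
  classical
  set k := n - (n + 1) / 3 with hk
  set S := (Finset.Ioc 0 (n + 1)).filter (fun j => ¬ 3 ∣ j) with hS
  have hcard : Fintype.card S = k + 1 := by
    have h1 := Finset.card_filter_add_card_filter_not (s := Finset.Ioc 0 (n + 1)) (fun j => 3 ∣ j)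
    rw [Nat.Ioc_filter_dvd_card_eq_div, Nat.card_Ioc] at h1
    rw [Fintype.card_coe, hS]
    omega
  have hsum : ∀ (a : S → ℝ) (h : ℝ),
      melnikov (∑ j, C (a j) * Chebyshev.U ℝ ((j : ℕ) - 1)) (Chebyshev.T ℝ 3) 0 (cos (π / 6)) h =
      ∑ j, a j * melnikov (Chebyshev.U ℝ ((j : ℕ) - 1)) (Chebyshev.T ℝ 3) 0 (cos (π / 6)) h := by
    intro a h
    simp only [← melnikov_C_mul]
    generalize (Finset.univ : Finset S) = s
    induction s using Finset.induction_on with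
    | empty => simp [melnikov]
    | insert i s hi ih => rw [Finset.sum_insert hi, Finset.sum_insert hi, melnikov_add, ih]
  obtain ⟨a, t, htmono, htI, hsign⟩ := exists_alternating (k := k) hcard
    (fun j h => melnikov (Chebyshev.U ℝ ((j : ℕ) - 1)) (Chebyshev.T ℝ 3) 0 (cos (π / 6)) h)
    (I := Ioo (-1) 0) (by
      intro a ha
      have hF : ∑ j : S, C (a j * sin ((j : ℕ) * (π / 3))) * Chebyshev.T ℝ (j : ℕ) ≠ 0 := by
        intro h0
        apply ha
        have hli := ((Chebyshev.chebyshevTsequence ℝ).linearIndependent.comp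
          (fun j : S => (j : ℕ)) Subtype.val_injective)
        have h1 := Fintype.linearIndependent_iff.mp hli
          (fun j => a j * sin ((j : ℕ) * (π / 3))) (by
            rw [← h0]
            refine Finset.sum_congr rfl fun j _ => ?_
            rw [smul_eq_C_mul]
            rfl)
        funext j
        refine (mul_eq_zero.mp (h1 j)).resolve_right fun hsin => ?_
        obtain ⟨z, hz⟩ := sin_eq_zero_iff.mp hsin
        have hj := (Finset.mem_filter.mp j.2).2
        apply hj
        have h2 : ((j : ℕ) : ℝ) = 3 * z := by
          have := pi_pos.ne'
          field_simp at hz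
          linarith
        have h3 : ((j : ℕ) : ℤ) = 3 * z := by exact_mod_cast h2
        omega
      obtain ⟨h, hh, hne⟩ := exists_integral_ne_zero hF
      refine ⟨h, hh, ?_⟩
      convert hne using 1
      simp only [melnikov_chebyshev, ← intervalIntegral.integral_const_mul]
      rw [← intervalIntegral.integral_finsetSum
        (fun j _ => Continuous.intervalIntegrable (by fun_prop) _ _)]
      refine intervalIntegral.integral_congr fun w _ => ?_
      simp only [eval_finsetSum, eval_mul, eval_C, Finset.sum_mul]
      exact Finset.sum_congr rfl fun j _ => by ring)
  simp only [← hsum] at hsign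
  refine ⟨∑ j, C (a j) * Chebyshev.U ℝ ((j : ℕ) - 1), fun _ => 0, fun _ => cos (π / 6),
    fun i => t i.castSucc, fun i => t i.succ, ⟨fun i => isCell_chebyshev_three (htI _).1
      (htmono i.castSucc_lt_succ) (htI _).2, fun i j hij =>
      Or.inr (disjoint_Ioo_castSucc_succ htmono hij), hsign⟩, ?_⟩
  · refine natDegree_sum_le_of_forall_le _ _ fun j _ => (natDegree_C_mul_le _ _).trans ?_
    have hj := Finset.mem_Ioc.mp (Finset.mem_filter.mp j.2).1
    have : ((j : ℕ) : ℤ) - 1 = (((j : ℕ) - 1 : ℕ) : ℤ) := by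
      rw [Nat.cast_sub hj.1]
      simp
    rw [this, Chebyshev.natDegree_U_natCast]
    omega

end Base

section Counting

theorem exists_cellFamily (p : ℕ) : ∀ n : ℕ, 3 * 2 ^ p - 1 ≤ n →
    ∃ (ι : Type) (_ : Fintype ι) (f G : ℝ[X]) (α β h₁ h₂ : ι → ℝ),
      IsCellFamily f G α β h₁ h₂ ∧ f.natDegree ≤ n ∧ G.natDegree = 3 * 2 ^ p ∧
      0 < G.leadingCoeff ∧
      ((p : ℝ) / 2 + 2 / 3) * n - (((p : ℝ) + 13 / 3) * (2 ^ p / 2) - ((p : ℝ) + 4 / 3)) ≤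
        Fintype.card ι := by
  induction p with
  | zero =>
    intro n _
    obtain ⟨f, α, β, h₁, h₂, hc, hf⟩ := exists_chebyshev_family n
    refine ⟨_, inferInstance, f, _, α, β, h₁, h₂, hc, hf, by simp, by simp, ?_⟩
    rw [Fintype.card_fin]
    have h1 : 2 * n ≤ 3 * (n - (n + 1) / 3) + 1 := by omega
    have h2 : (2 * n : ℝ) ≤ 3 * ((n - (n + 1) / 3 : ℕ) : ℝ) + 1 := by exact_mod_cast h1
    norm_num
    linarith
  | succ p ih =>
    intro n hn
    have h2p : 1 ≤ 2 ^ p := Nat.one_le_two_pow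
    rw [pow_succ] at hn
    obtain ⟨ι, _, f, G, α, β, h₁, h₂, hc, hf, hG, hl, hcard⟩ := ih ((n - 1) / 2) (by omega)
    obtain ⟨F, P, a, b, u, v, hc', hF, hP, hl'⟩ := hc.exists_double (n := n) (k := n / 2)
      (by omega) hl (by omega) (by omega)
    refine ⟨_, inferInstance, F, P, a, b, u, v, hc', hF, by rw [hP, hG]; ring, hl', ?_⟩
    simp only [Fintype.card_sum, Fintype.card_fin]
    push_cast
    have h2p' : (1 : ℝ) ≤ 2 ^ p := one_le_pow₀ (by norm_num)
    have hp0 : (0 : ℝ) ≤ p := p.cast_nonneg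
    obtain ⟨m, hm⟩ : ∃ m, m = (n - 1) / 2 := ⟨_, rfl⟩
    rw [← hm] at hcard
    rw [pow_succ]
    rcases Nat.even_or_odd' n with ⟨c, rfl | rfl⟩
    · have h1 : (c : ℝ) = m + 1 := by
        have : c = m + 1 := by omega
        exact_mod_cast this
      rw [show 2 * c / 2 = c by omega]
      push_cast
      rw [h1]
      nlinarith
    · have h1 : (c : ℝ) = m := by
        have : c = m := by omega
        exact_mod_cast this
      rw [show (2 * c + 1) / 2 = c by omega]
      push_cast
      rw [h1]
      nlinarith

end Counting

theorem stmt3 (p j n : ℕ) (hp : 1 ≤ p) (hj1 : 1 ≤ j) (hj2 : j ≤ 2 ^ p)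
    (hn : 3 * 2 ^ p - 1 ≤ n) :
    HGe n (3 * 2 ^ p - 2 + j)
      (((p : ℝ) / 2 + 2 / 3) * n
        - (((p : ℝ) + 13 / 3) * 2 ^ (p - 1) - ((p : ℝ) + 4 / 3))) := by
  obtain ⟨ι, _, f, G, α, β, h₁, h₂, hc, hf, hG, -, hcard⟩ := exists_cellFamily p n hn
  have h2p : 1 ≤ 2 ^ p := Nat.one_le_two_pow
  obtain ⟨f', g, hf', hg, ε₀, hε₀, h⟩ := hc.hGe (m := 3 * 2 ^ p - 2 + j) hf (by omega)
  refine ⟨f', g, hf', hg, ε₀, hε₀, fun ε h1 h2 => ?_⟩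
  obtain ⟨S, hS, hSc⟩ := h ε h1 h2
  refine ⟨S, hS, le_trans ?_ hSc⟩
  rwa [show (2 : ℝ) ^ (p - 1) = 2 ^ p / 2 by
    obtain ⟨q, rfl⟩ := Nat.exists_eq_add_of_le' hp
    rw [Nat.add_sub_cancel, pow_succ]
    ring]
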